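/- arXiv:2311.15234 — 2 statements merged into one kernel-verified Lean document; each statement's English description precedes it below -/
import Mathlib

section
/- Let X be the Cantor space over a finite alphabet 𝒜, T : X → X a computable map, and A ⊆ X a closed T-invariant set which is a topological attractor of T. Then A is a Π₂ closed set, i.e. its inner collection {w : [w] ∩ A ≠ ∅} is a Π₂ set of words. -/
open Filter Topology MeasureTheory Set
open scoped ENNReal NNReal

/-- Cylinder of a finite word in Cantor space: the set of sequences beginning with `w`. -/
def cyl {𝒜 : Type*} (w : List 𝒜) : Set (ℕ → 𝒜) :=
  {x | ∀ i : Fin w.length, x i = w.get i}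

/-- The shift map on Cantor space. -/
def shiftMap {𝒜 : Type*} (x : ℕ → 𝒜) : ℕ → 𝒜 := fun i => x (i + 1)

/-- ω-limit set of `x` under iteration of `T`: the set of accumulation points of the orbit. -/
def omegaSet {X : Type*} [TopologicalSpace X] (T : X → X) (x : X) : Set X :=
  {y | MapClusterPt y Filter.atTop fun n => T^[n] x}

/-- Realm of attraction `ρ(A) = {x : ω(x) ⊆ A}`. -/
def realm {X : Type*} [TopologicalSpace X] (T : X → X) (A : Set X) : Set X :=
  {x | omegaSet T x ⊆ A}

/-- `A` is a topological attractor of `T`: a closed invariant set whose realm of attraction is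
residual, and such that no strictly smaller closed subset has nonmeager realm of attraction. -/
def IsTopAttractor {X : Type*} [TopologicalSpace X] (T : X → X) (A : Set X) : Prop :=
  IsClosed A ∧ Set.MapsTo T A A ∧ realm T A ∈ residual X ∧
    ∀ A' : Set X, IsClosed A' → A' ⊂ A → IsMeagre (realm T A')

/-- `A` is a metric attractor of `T` w.r.t. `lam`: a closed invariant set whose realm of
attraction has full measure, and no strictly smaller closed subset has realm of positive
measure. -/
def IsMetricAttractor {X : Type*} [TopologicalSpace X] [MeasurableSpace X]
    (T : X → X) (lam : Measure X) (A : Set X) : Prop :=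
  IsClosed A ∧ Set.MapsTo T A A ∧ lam (realm T A) = 1 ∧
    ∀ A' : Set X, IsClosed A' → A' ⊂ A → lam (realm T A') = 0

/-- Empirical (Birkhoff) measures `ν_n(x) = (1/n) ∑_{i<n} δ_{T^i x}`. -/
noncomputable def empMeasure {X : Type*} [MeasurableSpace X] (T : X → X) (x : X) (n : ℕ) :
    Measure X :=
  (n : ℝ≥0∞)⁻¹ • ∑ i ∈ Finset.range n, Measure.dirac (T^[i] x)

/-- Weak-* convergence of a sequence of measures: integrals of continuous functions converge. -/
def WeakTendsto {X : Type*} [TopologicalSpace X] [MeasurableSpace X]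
    (μs : ℕ → Measure X) (μ : Measure X) : Prop :=
  ∀ φ : C(X, ℝ), Filter.Tendsto (fun n => ∫ x, φ x ∂(μs n)) Filter.atTop (nhds (∫ x, φ x ∂μ))

/-- Topological support of a measure: points all of whose open neighbourhoods have positive
measure. -/
def measSupport {X : Type*} [TopologicalSpace X] [MeasurableSpace X]
    (μ : Measure X) : Set X :=
  {x | ∀ U : Set X, IsOpen U → x ∈ U → 0 < μ U}

/-- `A` is a statistical (physical) attractor of `T` w.r.t. `lam`: there is a `T`-invariant
probability measure `μ` with support `A` such that for `lam`-a.e. `x` the empirical measures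
converge weak-* to `μ`. -/
def IsStatAttractor {X : Type*} [TopologicalSpace X] [MeasurableSpace X]
    (T : X → X) (lam : Measure X) (A : Set X) : Prop :=
  IsClosed A ∧ ∃ μ : Measure X, IsProbabilityMeasure μ ∧
    Measure.map T μ = μ ∧ measSupport μ = A ∧
    ∀ᵐ x ∂lam, WeakTendsto (empMeasure T x) μ

/-- `A` is strongly attracting: there is an open `U ⊇ A` with `T (closure U) ⊆ U` and
`A = ⋂ₙ Tⁿ(U)`. -/
def StronglyAttracting {X : Type*} [TopologicalSpace X] (T : X → X) (A : Set X) : Prop :=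
  ∃ U : Set X, IsOpen U ∧ A ⊆ U ∧ T '' (closure U) ⊆ U ∧ A = ⋂ n : ℕ, T^[n] '' U

/-- `S` is Σ₁ (recursively enumerable). -/
def SigmaOne {I : Type*} [Primcodable I] (S : Set I) : Prop :=
  ∃ f : I × ℕ → Bool, Computable f ∧ ∀ i, i ∈ S ↔ ∃ a, f (i, a) = true

/-- `S` is Π₁ (co-r.e.). -/
def PiOne {I : Type*} [Primcodable I] (S : Set I) : Prop := SigmaOne Sᶜ

/-- `S` is Σ₂. -/
def SigmaTwo {I : Type*} [Primcodable I] (S : Set I) : Prop :=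
  ∃ f : I × ℕ × ℕ → Bool, Computable f ∧ ∀ i, i ∈ S ↔ ∃ a, ∀ b, f (i, a, b) = true

/-- `S` is Π₂. -/
def PiTwo {I : Type*} [Primcodable I] (S : Set I) : Prop :=
  ∃ f : I × ℕ × ℕ → Bool, Computable f ∧ ∀ i, i ∈ S ↔ ∀ a, ∃ b, f (i, a, b) = true

/-- A map of Cantor space is computable if `(T x) n` is computed by a computable function from
`n` and the finite prefix `[x 0, …, x (α n)]` of `x`, for a computable modulus `α`. -/
def CantorComputable {𝒜 : Type} [Primcodable 𝒜] (T : (ℕ → 𝒜) → (ℕ → 𝒜)) : Prop :=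
  ∃ (α : ℕ → ℕ) (β : ℕ → List 𝒜 → 𝒜), Computable α ∧ Computable₂ β ∧
    ∀ (x : ℕ → 𝒜) (n : ℕ), T x n = β n (List.ofFn fun i : Fin (α n + 1) => x i)

/-- A Borel probability measure on Cantor space is computable if the measures of finite unions
of cylinders are uniformly lower-computable: `lam(⋃_{w ∈ W} [w]) = sup_k q (W, k)` for a
computable `q`. -/
def ComputableCantorMeasure {𝒜 : Type} [Primcodable 𝒜] [MeasurableSpace 𝒜]
    (lam : Measure (ℕ → 𝒜)) : Prop :=
  ∃ q : List (List 𝒜) × ℕ → ℚ, Computable q ∧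
    ∀ W : List (List 𝒜), (lam (⋃ w ∈ W, cyl w)).toReal = ⨆ k, (q (W, k) : ℝ)

/-- Indices of machines halting on input 0. -/
def HaltSet : Set ℕ := {e | ((Denumerable.ofNat Nat.Partrec.Code e).eval 0).Dom}

/-- Indices of total machines. -/
def TotSet : Set ℕ := {e | ∀ n, ((Denumerable.ofNat Nat.Partrec.Code e).eval n).Dom}

/-- Indices of machines with finite domain. -/
def FinSet : Set ℕ := {e | {n | ((Denumerable.ofNat Nat.Partrec.Code e).eval n).Dom}.Finite}

section Computability

variable {I α β σ : Type*} [Primcodable I] [Primcodable α] [Primcodable β] [Primcodable σ]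

/-- Iterating a computable function is computable. -/
theorem Computable.nat_iterate {f : α → ℕ} {g : α → σ} {h : α → σ → σ} (hf : Computable f)
    (hg : Computable g) (hh : Computable₂ h) : Computable fun a => (h a)^[f a] (g a) :=
  (Computable.nat_rec (h := fun a (p : ℕ × σ) => h a p.2) hf hg
    (hh.comp Computable.fst (Computable.snd.comp Computable.snd)).to₂).of_eq fun a => by
    induction f a with
    | zero => rfl
    | succ n ih => rw [Function.iterate_succ_apply', ← ih]

/-- A set is `Π₂` as soon as it is defined by a computable matrix whose two quantifiers range over
arbitrary `Primcodable` types. -/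
theorem PiTwo.of_forall_exists {S : Set I} {p : I × α × β → Bool} (hp : Computable p)
    (hS : ∀ i, i ∈ S ↔ ∀ a, ∃ b, p (i, a, b) = true) : PiTwo S := by
  refine ⟨fun q => Option.casesOn (motive := fun _ => Bool) (Encodable.decode (α := α) q.2.1) true
    fun a => Option.casesOn (motive := fun _ => Bool) (Encodable.decode (α := β) q.2.2) false
      fun b => p (q.1, a, b), ?_, fun i => ?_⟩
  · have h1 : Computable fun q : I × ℕ × ℕ => Encodable.decode (α := α) q.2.1 :=
      Computable.decode.comp (Computable.fst.comp Computable.snd)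
    have h2 : Computable fun r : (I × ℕ × ℕ) × α => Encodable.decode (α := β) r.1.2.2 :=
      Computable.decode.comp (Computable.snd.comp (Computable.snd.comp Computable.fst))
    have h3 : Computable fun s : ((I × ℕ × ℕ) × α) × β => p (s.1.1.1, s.1.2, s.2) :=
      hp.comp ((Computable.fst.comp (Computable.fst.comp Computable.fst)).pair
        ((Computable.snd.comp Computable.fst).pair Computable.snd))
    exact Computable.option_casesOn h1 (Computable.const true)
      (Computable.option_casesOn h2 (Computable.const false) h3.to₂).to₂
  · rw [hS]
    constructor
    · intro h n
      cases hn : Encodable.decode (α := α) n with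
      | none => exact ⟨0, by simp [hn]⟩
      | some a =>
        obtain ⟨b, hb⟩ := h a
        exact ⟨Encodable.encode b, by simpa [hn] using hb⟩
    · intro h a
      obtain ⟨m, hm⟩ := h (Encodable.encode a)
      cases hb : Encodable.decode (α := β) m with
      | none => simp [hb] at hm
      | some b => exact ⟨b, by simpa [hb] using hm⟩

theorem piTwo_empty : PiTwo (∅ : Set I) :=
  ⟨fun _ => false, Computable.const false, by simp⟩

end Computability

section Cylinders

variable {𝒜 : Type*}

theorem mem_cyl_iff {w : List 𝒜} {x : ℕ → 𝒜} : x ∈ cyl w ↔ (List.range w.length).map x = w := by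
  refine ⟨fun h => List.ext_getElem (by simp) fun i _ h2 => by simpa using h ⟨i, h2⟩,
    fun h i => ?_⟩
  have := List.getElem_of_eq h (i := i) (by simp)
  simpa using this

theorem mem_cyl_map_range (x : ℕ → 𝒜) (n : ℕ) : x ∈ cyl ((List.range n).map x) := by
  simp [mem_cyl_iff]

theorem map_range_take {w : List 𝒜} {x : ℕ → 𝒜} (hx : x ∈ cyl w) {k : ℕ} (hk : k ≤ w.length) :
    w.take k = (List.range k).map x := by
  rw [← mem_cyl_iff.1 hx, ← List.map_take, List.take_range, min_eq_left hk]

theorem mem_cyl_of_prefix {v w : List 𝒜} {x : ℕ → 𝒜} (h : v <+: w) (hx : x ∈ cyl w) :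
    x ∈ cyl v := by
  rw [mem_cyl_iff, ← map_range_take hx h.length_le, ← List.prefix_iff_eq_take.1 h]

theorem cyl_nonempty [Nonempty 𝒜] (w : List 𝒜) : (cyl w).Nonempty := by
  refine ⟨fun i => w.getD i (Classical.arbitrary 𝒜), fun i => ?_⟩
  simp

/-- An open subset of Cantor space contains, with each of its points, the cylinder of a prefix of
that point. -/
theorem exists_cyl_map_range_subset [TopologicalSpace 𝒜] {U : Set (ℕ → 𝒜)} (hU : IsOpen U)
    {x : ℕ → 𝒜} (hx : x ∈ U) : ∃ n, cyl ((List.range n).map x) ⊆ U := by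
  obtain ⟨s, u, hu, hsub⟩ := isOpen_pi_iff.1 hU x hx
  refine ⟨s.sup id + 1, fun y hy => hsub fun i hi => ?_⟩
  have hi' : i < s.sup id + 1 := Nat.lt_succ_of_le (Finset.le_sup (f := id) hi)
  have : y i = x i := by simpa using hy ⟨i, by simpa using hi'⟩
  rw [this]
  exact (hu i hi).2

variable [TopologicalSpace 𝒜] [DiscreteTopology 𝒜]

theorem isClopen_cyl (w : List 𝒜) : IsClopen (cyl w) := by
  have : cyl w = ⋂ i : Fin w.length, (fun x : ℕ → 𝒜 => x i) ⁻¹' {w.get i} := by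
    ext x
    simp [cyl]
  rw [this]
  exact isClopen_iInter_of_finite fun i => (isClopen_discrete _).preimage (continuous_apply _)

theorem continuous_of_finite_prefix {T : (ℕ → 𝒜) → (ℕ → 𝒜)} {α : ℕ → ℕ} {β : ℕ → List 𝒜 → 𝒜}
    (hT : ∀ x n, T x n = β n ((List.range (α n + 1)).map x)) : Continuous T := by
  refine continuous_pi fun n => continuous_discrete_rng.2 fun a => isOpen_iff_mem_nhds.2 ?_
  intro x hx
  refine mem_of_superset ((isClopen_cyl _).isOpen.mem_nhds (mem_cyl_map_range x (α n + 1))) ?_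
  intro y hy
  have h := mem_cyl_iff.1 hy
  simp only [List.length_map, List.length_range] at h
  simpa [hT, h] using hx

end Cylinders

section WordMap

variable {𝒜 : Type*} (α : ℕ → ℕ) (β : ℕ → List 𝒜 → 𝒜)

/-- Append to `acc`, a prefix of the image of a sequence beginning with `l`, the next letter of
that image if `l` is long enough to determine it. -/
def extendImage (l acc : List 𝒜) : List 𝒜 :=
  bif decide (α acc.length < l.length) then
    acc ++ [β acc.length (l.take (α acc.length + 1))]
  else acc

/-- A prefix of the image of any sequence beginning with `l` that is computed from `l`. -/
def wordMap (l : List 𝒜) : List 𝒜 := (extendImage α β l)^[l.length] []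

variable {α β}

theorem mem_cyl_wordMap {T : (ℕ → 𝒜) → (ℕ → 𝒜)}
    (hT : ∀ x n, T x n = β n ((List.range (α n + 1)).map x)) {l : List 𝒜} {x : ℕ → 𝒜}
    (hx : x ∈ cyl l) : T x ∈ cyl (wordMap α β l) := by
  unfold wordMap
  generalize l.length = k
  induction k with
  | zero => simp [mem_cyl_iff]
  | succ k ih =>
    rw [Function.iterate_succ_apply']
    set acc := (extendImage α β l)^[k] []
    unfold extendImage
    by_cases h : α acc.length < l.length
    · have ht := map_range_take hx (Nat.succ_le_of_lt h)
      have hacc := mem_cyl_iff.1 ih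
      simp only [h, decide_true, cond_true]
      rw [mem_cyl_iff, List.length_append, List.length_singleton, List.range_succ, List.map_append,
        hacc, ht]
      simp [hT]
    · simpa [h] using ih

theorem mem_cyl_wordMap_iterate {T : (ℕ → 𝒜) → (ℕ → 𝒜)}
    (hT : ∀ x n, T x n = β n ((List.range (α n + 1)).map x)) {l : List 𝒜} {x : ℕ → 𝒜}
    (hx : x ∈ cyl l) (n : ℕ) : T^[n] x ∈ cyl ((wordMap α β)^[n] l) := by
  induction n with
  | zero => exact hx
  | succ n ih =>
    rw [Function.iterate_succ_apply', Function.iterate_succ_apply']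
    exact mem_cyl_wordMap hT ih

theorem exists_le_length_wordMap (α : ℕ → ℕ) (β : ℕ → List 𝒜 → 𝒜) (m : ℕ) :
    ∃ L, ∀ l : List 𝒜, L ≤ l.length → m ≤ (wordMap α β l).length := by
  refine ⟨m + (Finset.range m).sup (fun i => α i + 1), fun l hl => ?_⟩
  have hα : ∀ i < m, α i < l.length := fun i hi => by
    have := Finset.le_sup (f := fun i => α i + 1) (Finset.mem_range.2 hi)
    omega
  have key : ∀ k, min k m ≤ ((extendImage α β l)^[k] []).length := by
    intro k
    induction k with
    | zero => simp
    | succ k ih =>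
      rw [Function.iterate_succ_apply']
      set acc := (extendImage α β l)^[k] []
      unfold extendImage
      by_cases h : α acc.length < l.length
      · simp only [h, decide_true, cond_true, List.length_append, List.length_singleton]
        omega
      · have : m ≤ acc.length := not_lt.1 fun h' => h (hα _ h')
        simp only [h, decide_false, cond_false]
        omega
  have := key l.length
  unfold wordMap
  omega

theorem exists_le_length_wordMap_iterate (α : ℕ → ℕ) (β : ℕ → List 𝒜 → 𝒜) (n m : ℕ) :
    ∃ L, ∀ l : List 𝒜, L ≤ l.length → m ≤ ((wordMap α β)^[n] l).length := by
  induction n generalizing m with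
  | zero => exact ⟨m, fun l hl => hl⟩
  | succ n ih =>
    obtain ⟨L, hL⟩ := exists_le_length_wordMap α β m
    obtain ⟨L', hL'⟩ := ih L
    refine ⟨L', fun l hl => ?_⟩
    rw [Function.iterate_succ_apply']
    exact hL _ (hL' l hl)

theorem computable₂_extendImage [Primcodable 𝒜] (hα : Computable α) (hβ : Computable₂ β) :
    Computable₂ (extendImage α β) := by
  have hlen : Computable fun p : List 𝒜 × List 𝒜 => p.2.length :=
    Computable.list_length.comp Computable.snd
  have hlt : Computable fun p : List 𝒜 × List 𝒜 => decide (α p.2.length < p.1.length) :=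
    Primrec.nat_lt.decide.to_comp.comp (hα.comp hlen) (Computable.list_length.comp Computable.fst)
  have htake : Computable fun p : List 𝒜 × List 𝒜 => p.1.take (α p.2.length + 1) :=
    Primrec.list_take.to_comp.comp (Computable.succ.comp (hα.comp hlen)) Computable.fst
  exact (Computable.cond hlt (Computable.list_concat.comp Computable.snd (hβ.comp hlen htake))
    Computable.snd).to₂

theorem computable_wordMap [Primcodable 𝒜] (hα : Computable α) (hβ : Computable₂ β) :
    Computable (wordMap α β) :=
  Computable.nat_iterate Computable.list_length (Computable.const []) (computable₂_extendImage hα hβ)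

end WordMap

section RecurrentCylinders

variable {X : Type*} [TopologicalSpace X] {T : X → X}

/-- An orbit that visits a closed subset of a compact space infinitely often accumulates there. -/
theorem omegaSet_inter_nonempty_of_frequently [CompactSpace X] {C : Set X} (hC : IsClosed C)
    {x : X} (hx : ∃ᶠ n in atTop, T^[n] x ∈ C) : (C ∩ omegaSet T x).Nonempty := by
  obtain ⟨y, hy, hcl⟩ := hC.isCompact.exists_mapClusterPt_of_frequently hx
  exact ⟨y, hy, hcl⟩

/-- Generic orbits visit infinitely often every clopen set meeting a topological attractor. -/
theorem IsTopAttractor.frequently_mem_residual {A C : Set X} (hA : IsTopAttractor T A)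
    (hC : IsOpen C) (hCA : (C ∩ A).Nonempty) :
    {x | ∃ᶠ n in atTop, T^[n] x ∈ C} ∈ residual X := by
  obtain ⟨hAcl, -, hres, hmin⟩ := hA
  have hss : A \ C ⊂ A := by
    obtain ⟨y, hyC, hyA⟩ := hCA
    exact ⟨sdiff_subset, fun h => (h hyA).2 hyC⟩
  have hm : (realm T (A \ C))ᶜ ∈ residual X := hmin _ (hAcl.sdiff hC) hss
  filter_upwards [hres, hm] with x hx hx'
  obtain ⟨y, hy, hy'⟩ := not_subset.1 hx'
  have hyC : y ∈ C := by_contra fun h => hy' ⟨hx hy, h⟩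
  exact MapClusterPt.frequently hy (hC.mem_nhds hyC)

/-- A clopen set meets a topological attractor iff the open sets of points entering it after any
given time are dense. -/
theorem IsTopAttractor.inter_nonempty_iff [CompactSpace X] [T2Space X] [Nonempty X]
    (hT : Continuous T) {A C : Set X} (hA : IsTopAttractor T A) (hC : IsClopen C) :
    (C ∩ A).Nonempty ↔ ∀ N, Dense {x | ∃ n, T^[N + n] x ∈ C} := by
  have hset : {x | ∃ᶠ n in atTop, T^[n] x ∈ C} = ⋂ N, {x | ∃ n, T^[N + n] x ∈ C} := by
    ext x
    simp only [frequently_atTop, mem_ofPred_eq, mem_iInter]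
    exact forall_congr' fun N => ⟨fun ⟨n, hn, h⟩ => ⟨n - N, by rwa [Nat.add_sub_cancel' hn]⟩,
      fun ⟨n, h⟩ => ⟨N + n, Nat.le_add_right _ _, h⟩⟩
  constructor
  · intro h N
    have hd := dense_of_mem_residual (hA.frequently_mem_residual hC.isOpen h)
    rw [hset] at hd
    exact hd.mono (iInter_subset _ N)
  · intro h
    have hopen : ∀ N, IsOpen {x | ∃ n, T^[N + n] x ∈ C} := fun N => by
      simp only [ofPred_exists]
      exact isOpen_iUnion fun n => hC.isOpen.preimage (hT.iterate _)
    have hres : {x | ∃ᶠ n in atTop, T^[n] x ∈ C} ∈ residual X := by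
      rw [hset]
      exact countable_iInter_mem.2 fun N => residual_of_dense_open (hopen N) (h N)
    obtain ⟨x, hx, hxA⟩ := (dense_of_mem_residual (inter_mem hres hA.2.2.1)).nonempty
    obtain ⟨y, hyC, hy⟩ := omegaSet_inter_nonempty_of_frequently hC.isClosed hx
    exact ⟨y, hyC, hxA hy⟩

end RecurrentCylinders

/-- Density of the set of points entering `[w]` after time `N`, in terms of finite words. -/
theorem dense_exists_iterate_mem_cyl_iff {𝒜 : Type*} [Nonempty 𝒜] [TopologicalSpace 𝒜]
    [DiscreteTopology 𝒜] {T : (ℕ → 𝒜) → (ℕ → 𝒜)} {α : ℕ → ℕ} {β : ℕ → List 𝒜 → 𝒜}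
    (hT : ∀ x n, T x n = β n ((List.range (α n + 1)).map x)) (w : List 𝒜) (N : ℕ) :
    Dense {x | ∃ n, T^[N + n] x ∈ cyl w} ↔
      ∀ v : List 𝒜, ∃ (n : ℕ) (u : List 𝒜), w <+: (wordMap α β)^[N + n] (v ++ u) := by
  constructor
  · intro hd v
    obtain ⟨x, hxv, n, hxw⟩ := hd.inter_open_nonempty _ (isClopen_cyl v).isOpen (cyl_nonempty v)
    obtain ⟨L, hL⟩ := exists_le_length_wordMap_iterate α β (N + n) w.length
    obtain ⟨u, hu⟩ : v <+: (List.range (v.length + L)).map x := by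
      rw [List.prefix_iff_eq_take, map_range_take (mem_cyl_map_range x _) (by simp),
        mem_cyl_iff.1 hxv]
    refine ⟨n, u, ?_⟩
    rw [hu, List.prefix_iff_eq_take, map_range_take
      (mem_cyl_wordMap_iterate hT (mem_cyl_map_range x _) (N + n)) (hL _ (by simp)),
      mem_cyl_iff.1 hxw]
  · intro h
    refine dense_iff_inter_open.2 fun U hU ⟨y, hy⟩ => ?_
    obtain ⟨k, hk⟩ := exists_cyl_map_range_subset hU hy
    obtain ⟨n, u, hu⟩ := h ((List.range k).map y)
    obtain ⟨x, hx⟩ := cyl_nonempty ((List.range k).map y ++ u)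
    exact ⟨x, hk (mem_cyl_of_prefix (List.prefix_append _ _) hx), n,
      mem_cyl_of_prefix hu (mem_cyl_wordMap_iterate hT hx _)⟩

/-- A topological attractor of a computable map of Cantor space is a Π₂ closed set: its inner
collection of cylinders is Π₂. -/
theorem stmt5 {𝒜 : Type} [Fintype 𝒜] [Primcodable 𝒜]
    [TopologicalSpace 𝒜] [DiscreteTopology 𝒜]
    {T : (ℕ → 𝒜) → (ℕ → 𝒜)} (hT : CantorComputable T)
    {A : Set (ℕ → 𝒜)} (hA : IsTopAttractor T A) :
    PiTwo {w : List 𝒜 | (cyl w ∩ A).Nonempty} := by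
  rcases isEmpty_or_nonempty 𝒜 with h𝒜 | h𝒜
  · convert piTwo_empty (I := List 𝒜)
    exact eq_empty_of_forall_notMem fun w ⟨x, _⟩ => isEmptyElim (x 0)
  classical
  obtain ⟨α, β, hα, hβ, hT⟩ := hT
  replace hT : ∀ x n, T x n = β n ((List.range (α n + 1)).map x) := fun x n => by
    rw [hT]
    exact congrArg (β n) (List.ext_getElem (by simp) fun i _ _ => by
      simp only [List.getElem_ofFn, List.getElem_map, List.getElem_range])
  have hword : Computable fun q : List 𝒜 × (ℕ × List 𝒜) × ℕ × List 𝒜 =>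
      (wordMap α β)^[q.2.1.1 + q.2.2.1] (q.2.1.2 ++ q.2.2.2) := by
    have h1 := Computable.fst.comp (Computable.snd (α := List 𝒜) (β := (ℕ × List 𝒜) × ℕ × List 𝒜))
    have h2 := Computable.snd.comp (Computable.snd (α := List 𝒜) (β := (ℕ × List 𝒜) × ℕ × List 𝒜))
    exact Computable.nat_iterate
      (Primrec.nat_add.to_comp.comp (Computable.fst.comp h1) (Computable.fst.comp h2))
      (Computable.list_append.comp (Computable.snd.comp h1) (Computable.snd.comp h2))
      ((computable_wordMap hα hβ).comp Computable.snd).to₂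
  refine PiTwo.of_forall_exists (α := ℕ × List 𝒜) (β := ℕ × List 𝒜)
    (p := fun q => decide (q.1 =
      ((wordMap α β)^[q.2.1.1 + q.2.2.1] (q.2.1.2 ++ q.2.2.2)).take q.1.length))
    (Primrec.eq.decide.to_comp.comp Computable.fst (Primrec.list_take.to_comp.comp
      (Computable.list_length.comp Computable.fst) hword)) fun w => ?_
  rw [mem_ofPred_eq, hA.inter_nonempty_iff (continuous_of_finite_prefix hT) (isClopen_cyl w)]
  simp only [dense_exists_iterate_mem_cyl_iff hT, decide_eq_true_eq, ← List.prefix_iff_eq_take,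
    Prod.forall, Prod.exists]
end

section
/- There exist a computable map T on the Cantor space X over the alphabet {0,1} and a closed T-invariant set A ⊆ X such that: (i) the inner collection {w : [w] ∩ A ≠ ∅} is Π₁ and the complement of Halt many-one reduces to it; (ii) A is shift-invariant, T coincides with the shift σ on A, the shift on A is topologically mixing (for all nonempty relatively open U, V ⊆ A there is N with σ^{-n}(U) ∩ V ∩ A ≠ ∅ for all n ≥ N), and the topological entropy of σ restricted to A is positive; (iii) A = ⋂_{n∈ℕ} T^n(X), A is strongly attracting, and ω(x) ⊆ A for every x ∈ X; (iv) A is a topological attractor of T, and for every shift-ergodic fully supported Borel probability measure λ on X, A is a metric attractor and a statistical attractor of T with respect to λ, and the corresponding T-invariant measure μ supported on A is not a computable measure. -/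
open Filter Topology MeasureTheory Set
open scoped ENNReal NNReal

/-- The maximum of `0` and the first `n` Birkhoff sums, defined recursively. -/
def maxBirkhoffSum {α : Type*} (T : α → α) (f : α → ℝ) : ℕ → α → ℝ
  | 0 => fun _ => 0
  | n + 1 => fun x => max 0 (f x + maxBirkhoffSum T f n (T x))

theorem maxBirkhoffSum_nonneg {α : Type*} (T : α → α) (f : α → ℝ) (n : ℕ) (x : α) :
    0 ≤ maxBirkhoffSum T f n x := by
  cases n with
  | zero => exact le_rfl
  | succ n => exact le_max_left _ _

theorem maxBirkhoffSum_le_succ {α : Type*} (T : α → α) (f : α → ℝ) (n : ℕ) (x : α) :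
    maxBirkhoffSum T f n x ≤ maxBirkhoffSum T f (n + 1) x := by
  induction n generalizing x with
  | zero => exact maxBirkhoffSum_nonneg T f 1 x
  | succ n ih => exact max_le_max le_rfl (add_le_add le_rfl (ih (T x)))

theorem monotone_maxBirkhoffSum {α : Type*} (T : α → α) (f : α → ℝ) (x : α) :
    Monotone fun n => maxBirkhoffSum T f n x :=
  monotone_nat_of_le_succ fun n => maxBirkhoffSum_le_succ T f n x

theorem birkhoffSum_le_maxBirkhoffSum {α : Type*} (T : α → α) (f : α → ℝ) (n : ℕ) (x : α) :
    birkhoffSum T f n x ≤ maxBirkhoffSum T f n x := by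
  induction n generalizing x with
  | zero => simp [maxBirkhoffSum]
  | succ n ih =>
    rw [birkhoffSum_succ']
    exact (add_le_add le_rfl (ih (T x))).trans (le_max_right _ _)

theorem measurable_maxBirkhoffSum {α : Type*} [MeasurableSpace α] {T : α → α} {f : α → ℝ}
    (hT : Measurable T) (hf : Measurable f) (n : ℕ) : Measurable (maxBirkhoffSum T f n) := by
  induction n with
  | zero => exact measurable_const
  | succ n ih => exact measurable_const.max (hf.add (ih.comp hT))

theorem integrable_maxBirkhoffSum {α : Type*} [MeasurableSpace α] {μ : Measure α} {T : α → α}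
    {f : α → ℝ} (hT : MeasurePreserving T μ μ) (hf : Integrable f μ) (n : ℕ) :
    Integrable (maxBirkhoffSum T f n) μ := by
  induction n with
  | zero => exact integrable_zero _ _ _
  | succ n ih =>
    have h := (hf.add (hT.integrable_comp_of_integrable ih)).pos_part
    refine h.congr (.of_forall fun x => ?_)
    simp [maxBirkhoffSum, max_comm]

/-- A maximal ergodic theorem: if `f` has negative integral then almost every sequence of Birkhoff
sums of `f` is bounded above. -/
theorem Ergodic.ae_birkhoffSum_bounded {α : Type*} [MeasurableSpace α] {μ : Measure α}
    [IsProbabilityMeasure μ] {T : α → α} (hT : Ergodic T μ) {f : α → ℝ} (hfm : Measurable f)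
    (hf : Integrable f μ) (hneg : ∫ x, f x ∂μ < 0) :
    ∀ᵐ x ∂μ, ∃ C : ℝ, ∀ n, birkhoffSum T f n x ≤ C := by
  set M := maxBirkhoffSum T f with hM
  have hMm : ∀ n, Measurable (M n) := measurable_maxBirkhoffSum hT.measurable hfm
  have hMi : ∀ n, Integrable (M n) μ :=
    integrable_maxBirkhoffSum hT.toMeasurePreserving hf
  have hM0 : ∀ n x, 0 ≤ M n x := maxBirkhoffSum_nonneg T f
  set E : Set α := {x | ∀ C : ℕ, ∃ n, (C : ℝ) < M n x} with hE
  have hEm : MeasurableSet E := by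
    have : E = ⋂ C : ℕ, ⋃ n : ℕ, {x | (C : ℝ) < M n x} := by
      ext x; simp [hE]
    rw [this]
    exact .iInter fun C => .iUnion fun n => measurableSet_lt measurable_const (hMm n)
  have hEinv : T ⁻¹' E = E := by
    ext x
    simp only [hE, mem_preimage, mem_ofPred_eq]
    constructor
    · intro h C
      obtain ⟨D, hD⟩ := exists_nat_gt ((C : ℝ) - f x)
      obtain ⟨n, hn⟩ := h D
      refine ⟨n + 1, lt_max_of_lt_right ?_⟩
      change (C : ℝ) < f x + M n (T x)
      linarith
    · intro h C
      obtain ⟨D, hD⟩ := exists_nat_gt ((C : ℝ) + f x)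
      obtain ⟨n, hn⟩ := h D
      cases n with
      | zero => exact absurd hn (not_lt.2 (by simp [hM, maxBirkhoffSum]))
      | succ n =>
        refine ⟨n, ?_⟩
        rcases lt_max_iff.1 hn with h0 | h1
        · exact absurd h0 (not_lt.2 (by positivity))
        · change (D : ℝ) < f x + M n (T x) at h1
          linarith
  rcases hT.toPreErgodic.ae_mem_or_ae_notMem hEm hEinv with h | h
  · exfalso
    have hle : ∀ n, 0 ≤ ∫ x, max (-M n (T x)) (f x) ∂μ := by
      intro n
      have hi : Integrable (fun x => M n (T x)) μ :=
        hT.toMeasurePreserving.integrable_comp_of_integrable (hMi n)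
      have h1 : ∀ x, max (-M n (T x)) (f x) = M (n + 1) x - M n (T x) := by
        intro x
        change _ = max 0 (f x + M n (T x)) - M n (T x)
        rw [← max_sub_sub_right]
        congr 1 <;> ring
      have h2 : ∫ x, M n (T x) ∂μ = ∫ x, M n x ∂μ := by
        conv_rhs => rw [← hT.map_eq]
        rw [integral_map hT.measurable.aemeasurable (hMm n).aestronglyMeasurable]
      simp_rw [h1]
      rw [integral_sub (hMi (n + 1)) hi, h2, sub_nonneg]
      exact integral_mono (hMi n) (hMi (n + 1)) (maxBirkhoffSum_le_succ T f n)
    have hlim : Tendsto (fun n => ∫ x, max (-M n (T x)) (f x) ∂μ) atTop (𝓝 (∫ x, f x ∂μ)) := by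
      refine tendsto_integral_of_dominated_convergence (fun x => |f x|)
        (fun n => ((((hMm n).comp hT.measurable).neg).max hfm).aestronglyMeasurable) hf.abs
        (fun n => .of_forall fun x => ?_) ?_
      · have := hM0 n (T x)
        rw [Real.norm_eq_abs, abs_le]
        exact ⟨(neg_abs_le _).trans (le_max_right _ _),
          max_le (by linarith [abs_nonneg (f x)]) (le_abs_self _)⟩
      · filter_upwards [h] with x hx
        rw [← hEinv] at hx
        obtain ⟨D, hD⟩ := exists_nat_gt (-f x)
        obtain ⟨n, hn⟩ := hx D
        refine tendsto_const_nhds.congr' ?_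
        filter_upwards [eventually_ge_atTop n] with m hm
        have := monotone_maxBirkhoffSum T f (T x) hm
        rw [max_eq_right]
        change M n (T x) ≤ M m (T x) at this
        linarith
    exact absurd (ge_of_tendsto' hlim hle) (not_le.2 hneg)
  · filter_upwards [h] with x hx
    simp only [hE, mem_ofPred_eq, not_forall, not_exists, not_lt] at hx
    obtain ⟨C, hC⟩ := hx
    exact ⟨C, fun n => (birkhoffSum_le_maxBirkhoffSum T f n x).trans (hC n)⟩

/-- One half of the pointwise ergodic theorem. -/
theorem Ergodic.ae_eventually_birkhoffAverage_lt {α : Type*} [MeasurableSpace α] {μ : Measure α}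
    [IsProbabilityMeasure μ] {T : α → α} (hT : Ergodic T μ) {f : α → ℝ} (hfm : Measurable f)
    (hf : Integrable f μ) :
    ∀ᵐ x ∂μ, ∀ c, ∫ x, f x ∂μ < c → ∀ᶠ n : ℕ in atTop, birkhoffAverage ℝ T f n x < c := by
  have key : ∀ k : ℕ, ∀ᵐ x ∂μ, ∃ C : ℝ, ∀ n,
      birkhoffSum T (fun x => f x - (∫ x, f x ∂μ + 1 / ((k : ℝ) + 1))) n x ≤ C := by
    intro k
    refine hT.ae_birkhoffSum_bounded (hfm.sub measurable_const) (hf.sub (integrable_const _)) ?_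
    rw [integral_sub hf (integrable_const _)]
    have : (0 : ℝ) < 1 / ((k : ℝ) + 1) := by positivity
    simp only [integral_const, probReal_univ, smul_eq_mul, one_mul]
    linarith
  filter_upwards [ae_all_iff.2 key] with x hx c hc
  obtain ⟨k, hk⟩ := exists_nat_one_div_lt (sub_pos.2 hc)
  obtain ⟨C, hC⟩ := hx k
  have hd : 0 < c - (∫ x, f x ∂μ + 1 / ((k : ℝ) + 1)) := by linarith
  obtain ⟨N, hN⟩ := exists_nat_gt (C / (c - (∫ x, f x ∂μ + 1 / ((k : ℝ) + 1))))
  filter_upwards [eventually_ge_atTop (max N 1)] with n hn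
  have hn1 : (0 : ℝ) < n := by exact_mod_cast (le_max_right N 1).trans hn
  have hnN : (N : ℝ) ≤ n := by exact_mod_cast (le_max_left N 1).trans hn
  have h1 := hC n
  rw [birkhoffSum, Finset.sum_sub_distrib, Finset.sum_const, Finset.card_range, nsmul_eq_mul] at h1
  rw [birkhoffAverage, birkhoffSum, smul_eq_mul, inv_mul_lt_iff₀ hn1]
  have h2 := (div_lt_iff₀ hd).1 (hN.trans_le hnN)
  linarith

/-- The pointwise ergodic theorem of Birkhoff for an ergodic probability measure. -/
theorem Ergodic.ae_tendsto_birkhoffAverage {α : Type*} [MeasurableSpace α] {μ : Measure α}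
    [IsProbabilityMeasure μ] {T : α → α} (hT : Ergodic T μ) {f : α → ℝ} (hfm : Measurable f)
    (hf : Integrable f μ) :
    ∀ᵐ x ∂μ, Tendsto (fun n => birkhoffAverage ℝ T f n x) atTop (𝓝 (∫ x, f x ∂μ)) := by
  filter_upwards [hT.ae_eventually_birkhoffAverage_lt hfm hf,
    hT.ae_eventually_birkhoffAverage_lt hfm.neg hf.neg] with x h1 h2
  refine tendsto_order.2 ⟨fun c hc => ?_, fun c hc => h1 c hc⟩
  have h3 := h2 (-c) (by simpa [integral_neg] using hc)
  filter_upwards [h3] with n hn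
  have : birkhoffAverage ℝ T (-f) n x = -birkhoffAverage ℝ T f n x := by
    simp [birkhoffAverage, birkhoffSum]
  rw [this] at hn
  linarith

/-- The word `0 0 1^(e+1) 0 0` occurs in `x` at position `i`. -/
def OccursAt (e i : ℕ) (x : ℕ → Bool) : Prop :=
  x i = false ∧ x (i + 1) = false ∧ (∀ k < e + 1, x (i + 2 + k) = true) ∧
    x (i + e + 3) = false ∧ x (i + e + 4) = false

/-- The machine of index `e ≤ s` halts on input `0` within `s` steps. -/
def HaltsWithin (s e : ℕ) : Prop :=
  e ≤ s ∧ (Nat.Partrec.Code.evaln s (Denumerable.ofNat Nat.Partrec.Code e) 0).isSome = true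

open Classical in
/-- Flip the first letter of every occurrence at a position `i` of a word of index `e` such that
`Q i e`. -/
noncomputable def eraseWords (Q : ℕ → ℕ → Prop) (x : ℕ → Bool) : ℕ → Bool :=
  fun i => x i || decide (∃ e, Q i e ∧ OccursAt e i x)

/-- The rule erasing the words which are known to be forbidden at the stage given by their
position. -/
noncomputable def stageErase : (ℕ → Bool) → (ℕ → Bool) := eraseWords HaltsWithin

/-- The rule erasing all forbidden words. -/
noncomputable def fullErase : (ℕ → Bool) → (ℕ → Bool) := eraseWords fun _ e => e ∈ HaltSet

/-- The map with a `Π₁`-complete attractor. -/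
noncomputable def haltMap (x : ℕ → Bool) : ℕ → Bool := shiftMap (stageErase x)

/-- The subshift whose forbidden words are the `0 0 1^(e+1) 0 0` with `e` halting. -/
def haltShift : Set (ℕ → Bool) := {x | ∀ i, ∀ e ∈ HaltSet, ¬ OccursAt e i x}

/-- The sequence that reads `x` up to `p`, then `1 0 1 1 ⋯ 1`, then `y` from position `n` on. -/
def glue (p : ℕ) (x : ℕ → Bool) (n : ℕ) (y : ℕ → Bool) : ℕ → Bool :=
  fun i => if i < p then x i else if i < n then decide (i ≠ p + 1) else y (i - n)

theorem mem_haltShift {x : ℕ → Bool} :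
    x ∈ haltShift ↔ ∀ i, ∀ e ∈ HaltSet, ¬ OccursAt e i x := Iff.rfl

theorem iterate_shiftMap {𝒜 : Type*} (n : ℕ) (x : ℕ → 𝒜) (i : ℕ) :
    shiftMap^[n] x i = x (i + n) := by
  induction n generalizing x with
  | zero => rfl
  | succ n ih =>
    rw [Function.iterate_succ_apply, ih]
    rfl

theorem occursAt_iterate_shiftMap {e i n : ℕ} {x : ℕ → Bool} :
    OccursAt e i (shiftMap^[n] x) ↔ OccursAt e (i + n) x := by
  simp only [OccursAt, iterate_shiftMap]
  have h : ∀ k, i + n + k = i + k + n := fun k => by omega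
  simp only [Nat.add_assoc, Nat.add_comm, Nat.add_left_comm]

theorem occursAt_shiftMap {e i : ℕ} {x : ℕ → Bool} :
    OccursAt e i (shiftMap x) ↔ OccursAt e (i + 1) x :=
  occursAt_iterate_shiftMap (n := 1)

theorem OccursAt.congr {e i : ℕ} {x y : ℕ → Bool} (h : OccursAt e i x)
    (hxy : ∀ k < i + e + 5, i ≤ k → y k = x k) : OccursAt e i y := by
  obtain ⟨h1, h2, h3, h4, h5⟩ := h
  refine ⟨?_, ?_, fun k hk => ?_, ?_, ?_⟩
  · rw [hxy _ (by omega) (by omega), h1]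
  · rw [hxy _ (by omega) (by omega), h2]
  · rw [hxy _ (by omega) (by omega), h3 k hk]
  · rw [hxy _ (by omega) (by omega), h4]
  · rw [hxy _ (by omega) (by omega), h5]

theorem OccursAt.unique {e e' i : ℕ} {x : ℕ → Bool} (h : OccursAt e i x) (h' : OccursAt e' i x) :
    e = e' := by
  obtain ⟨-, -, h3, h4, -⟩ := h
  obtain ⟨-, -, h3', h4', -⟩ := h'
  rcases lt_trichotomy e e' with hlt | heq | hlt
  · have := h3' (e + 1) (by omega)
    rw [show i + 2 + (e + 1) = i + e + 3 by omega, h4] at this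
    cases this
  · exact heq
  · have := h3 (e' + 1) (by omega)
    rw [show i + 2 + (e' + 1) = i + e' + 3 by omega, h4'] at this
    cases this

/-- An occurrence cannot cross a separator `1 0 1`. -/
theorem OccursAt.add_lt_of_separator {e i p : ℕ} {x : ℕ → Bool} (h : OccursAt e i x)
    (h1 : x p = true) (h2 : x (p + 1) = false) (h3 : x (p + 2) = true) (hi : i < p) :
    i + e + 4 < p := by
  obtain ⟨-, g2, g3, g4, g5⟩ := h
  by_contra hc
  have key : ∀ m, x m = false → p ≠ m := by
    rintro m hm rfl
    simp [hm] at h1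
  have n2 := key _ g2
  have n4 := key _ g4
  have n5 := key _ g5
  by_cases hlast : p + 1 = i + e + 3
  · rw [show i + e + 4 = p + 2 by omega, h3] at g5
    cases g5
  · have := g3 (p - i - 1) (by omega)
    rw [show i + 2 + (p - i - 1) = p + 1 by omega, h2] at this
    cases this

theorem haltsWithin_mono {s t e : ℕ} (h : s ≤ t) (he : HaltsWithin s e) : HaltsWithin t e := by
  refine ⟨he.1.trans h, ?_⟩
  obtain ⟨a, ha⟩ := Option.isSome_iff_exists.1 he.2
  exact Option.isSome_iff_exists.2 ⟨a, Nat.Partrec.Code.evaln_mono h ha⟩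

theorem mem_haltSet_iff {e : ℕ} : e ∈ HaltSet ↔ ∃ s, HaltsWithin s e := by
  constructor
  · intro h
    obtain ⟨a, ha⟩ := Part.dom_iff_mem.1 h
    obtain ⟨k, hk⟩ := Nat.Partrec.Code.evaln_complete.1 ha
    exact ⟨max k e, le_max_right _ _, Option.isSome_iff_exists.2
      ⟨a, Nat.Partrec.Code.evaln_mono (le_max_left _ _) hk⟩⟩
  · rintro ⟨s, -, hs⟩
    obtain ⟨a, ha⟩ := Option.isSome_iff_exists.1 hs
    exact Part.dom_iff_mem.2 ⟨a, Nat.Partrec.Code.evaln_sound ha⟩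

theorem HaltsWithin.mem_haltSet {s e : ℕ} (h : HaltsWithin s e) : e ∈ HaltSet :=
  mem_haltSet_iff.2 ⟨s, h⟩

theorem le_eraseWords {Q : ℕ → ℕ → Prop} {x : ℕ → Bool} {i : ℕ} (h : eraseWords Q x i = false) :
    x i = false := by
  simp only [eraseWords, Bool.or_eq_false_iff] at h
  exact h.1

theorem eraseWords_eq_of_not {Q : ℕ → ℕ → Prop} {x : ℕ → Bool} {i : ℕ}
    (h : ∀ e, Q i e → ¬ OccursAt e i x) : eraseWords Q x i = x i := by
  have : ¬ ∃ e, Q i e ∧ OccursAt e i x := fun ⟨e, he, ho⟩ => h e he ho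
  simp [eraseWords, this]

theorem eraseWords_eq_true {Q : ℕ → ℕ → Prop} {x : ℕ → Bool} {i e : ℕ}
    (h : Q i e) (ho : OccursAt e i x) : eraseWords Q x i = true := by
  have : ∃ e, Q i e ∧ OccursAt e i x := ⟨e, h, ho⟩
  simp only [eraseWords, this, decide_true, Bool.or_true]

/-- Erasing words does not create new occurrences. -/
theorem OccursAt.of_eraseWords {Q : ℕ → ℕ → Prop} {e i : ℕ} {x : ℕ → Bool}
    (h : OccursAt e i (eraseWords Q x)) : OccursAt e i x := by
  obtain ⟨h1, h2, h3, h4, h5⟩ := h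
  refine ⟨le_eraseWords h1, le_eraseWords h2, fun k hk => ?_, le_eraseWords h4, le_eraseWords h5⟩
  by_contra hx
  rw [Bool.not_eq_true] at hx
  obtain ⟨f, hQ, ho⟩ : ∃ f, Q (i + 2 + k) f ∧ OccursAt f (i + 2 + k) x := by
    by_contra hn
    have := eraseWords_eq_of_not (Q := Q) (x := x) (i := i + 2 + k)
      fun f hf ho => hn ⟨f, hf, ho⟩
    rw [h3 k hk, hx] at this
    cases this
  obtain ⟨-, g2, g3, -, -⟩ := ho
  have g := g3 0 (by omega)
  by_cases hk' : k + 1 < e + 1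
  · have hone := h3 (k + 1) hk'
    have : ∀ f', Q (i + 2 + k + 1) f' → ¬ OccursAt f' (i + 2 + k + 1) x := by
      rintro f' - ⟨-, q2, -⟩
      rw [show i + 2 + k + 1 + 1 = i + 2 + k + 2 + 0 by omega, g] at q2
      cases q2
    have := eraseWords_eq_of_not this
    rw [g2, show i + 2 + k + 1 = i + 2 + (k + 1) by omega, hone] at this
    cases this
  · have := le_eraseWords h5
    rw [show i + e + 4 = i + 2 + k + 2 + 0 by omega, g] at this
    cases this

theorem OccursAt.not_of_eraseWords {Q : ℕ → ℕ → Prop} {e i : ℕ} {x : ℕ → Bool}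
    (h : OccursAt e i (eraseWords Q x)) : ¬ Q i e := by
  intro hQ
  have := eraseWords_eq_true hQ h.of_eraseWords
  rw [h.1] at this
  cases this

theorem eraseWords_eq_self {Q : ℕ → ℕ → Prop} {x : ℕ → Bool}
    (h : ∀ i e, Q i e → ¬ OccursAt e i x) : eraseWords Q x = x :=
  funext fun i => eraseWords_eq_of_not (h i)

theorem fullErase_mem (x : ℕ → Bool) : fullErase x ∈ haltShift :=
  fun _ _ he h => h.not_of_eraseWords he

theorem fullErase_shiftMap (x : ℕ → Bool) : fullErase (shiftMap x) = shiftMap (fullErase x) := by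
  funext i
  have h : (∃ e, e ∈ HaltSet ∧ OccursAt e i (shiftMap x)) ↔
      ∃ e, e ∈ HaltSet ∧ OccursAt e (i + 1) x := by simp only [occursAt_shiftMap]
  simp only [fullErase, eraseWords, shiftMap]
  congr 1
  exact decide_eq_decide.2 h

theorem fullErase_iterate_shiftMap (n : ℕ) (x : ℕ → Bool) :
    fullErase (shiftMap^[n] x) = shiftMap^[n] (fullErase x) :=
  Function.Semiconj.iterate_right fullErase_shiftMap n x

theorem haltMap_iterate (n : ℕ) (x : ℕ → Bool) :
    haltMap^[n + 1] x = shiftMap^[n + 1] (stageErase x) := by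
  induction n with
  | zero => rfl
  | succ n ih =>
    rw [Function.iterate_succ_apply', ih, Function.iterate_succ_apply' shiftMap (n + 1)]
    refine congrArg shiftMap (eraseWords_eq_self fun i e hQ ho => ?_)
    rw [occursAt_iterate_shiftMap] at ho
    exact ho.not_of_eraseWords (haltsWithin_mono (by omega) hQ)

theorem haltMap_iterate_of_pos {n : ℕ} (hn : 0 < n) (x : ℕ → Bool) :
    haltMap^[n] x = shiftMap^[n] (stageErase x) := by
  obtain ⟨m, rfl⟩ := Nat.exists_eq_succ_of_ne_zero hn.ne'
  exact haltMap_iterate m x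

theorem stageErase_eq_self {x : ℕ → Bool} (hx : x ∈ haltShift) : stageErase x = x :=
  eraseWords_eq_self fun i _ hQ => hx i _ hQ.mem_haltSet

theorem haltMap_eq_shiftMap {x : ℕ → Bool} (hx : x ∈ haltShift) : haltMap x = shiftMap x := by
  rw [haltMap, stageErase_eq_self hx]

theorem mapsTo_shiftMap_haltShift : MapsTo shiftMap haltShift haltShift :=
  fun _ hx i e he h => hx (i + 1) e he (occursAt_shiftMap.1 h)

theorem mapsTo_haltMap_haltShift : MapsTo haltMap haltShift haltShift := fun x hx => by
  rw [haltMap_eq_shiftMap hx]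
  exact mapsTo_shiftMap_haltShift hx

theorem OccursAt.of_glue {e i p n : ℕ} {x y : ℕ → Bool} (hn : p + 3 ≤ n)
    (h : OccursAt e i (glue p x n y)) : (i + e + 4 < p ∧ OccursAt e i x) ∨
      (n ≤ i ∧ OccursAt e (i - n) y) := by
  have hp : ∀ k, p ≤ k → k < n → glue p x n y k = decide (k ≠ p + 1) := fun k h1 h2 => by
    simp [glue, h1, h2]
  rcases lt_or_ge i p with hi | hi
  · have hlt := h.add_lt_of_separator (p := p) (by simp [hp p le_rfl (by omega)])
      (by simp [hp (p + 1) (by omega) (by omega)]) (by simp [hp (p + 2) (by omega) (by omega)]) hi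
    refine .inl ⟨hlt, h.congr fun k hk _ => ?_⟩
    simp [glue, show k < p by omega]
  · rcases lt_or_ge i n with hi' | hi'
    · exfalso
      have h1 := h.1
      have h2 := h.2.1
      rw [hp i hi hi'] at h1
      have : i = p + 1 := by simpa using h1
      rw [hp (i + 1) (by omega) (by omega)] at h2
      simp at h2
      omega
    · refine .inr ⟨hi', ?_⟩
      have : shiftMap^[n] (glue p x n y) = y := by
        funext k
        simp [iterate_shiftMap, glue]
        omega
      rw [← this, occursAt_iterate_shiftMap, Nat.sub_add_cancel hi']
      exact h

theorem glue_mem_haltShift {p n : ℕ} {x y : ℕ → Bool} (hn : p + 3 ≤ n)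
    (hx : ∀ i, ∀ e ∈ HaltSet, i + e + 4 < p → ¬ OccursAt e i x) (hy : y ∈ haltShift) :
    glue p x n y ∈ haltShift := by
  intro i e he h
  rcases h.of_glue hn with ⟨h1, h2⟩ | ⟨-, h2⟩
  · exact hx i e he h1 h2
  · exact hy _ e he h2

theorem const_true_mem_haltShift : (fun _ => true) ∈ haltShift :=
  fun _ _ _ h => Bool.noConfusion h.1

theorem surjOn_shiftMap_haltShift : haltShift ⊆ shiftMap '' haltShift := by
  intro y hy
  refine ⟨fun i => i.casesOn true y, ?_, rfl⟩
  intro i e he h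
  cases i with
  | zero => exact Bool.noConfusion h.1
  | succ i => exact hy i e he (occursAt_shiftMap.2 h)

theorem haltShift_eq_iInter : haltShift = ⋂ n : ℕ, haltMap^[n] '' univ := by
  refine subset_antisymm (subset_iInter fun n => ?_) fun y hy i e he h => ?_
  · have : haltShift ⊆ haltMap^[n] '' haltShift := by
      induction n with
      | zero => simp
      | succ n ih =>
        intro y hy
        obtain ⟨z, hz, rfl⟩ := surjOn_shiftMap_haltShift hy
        obtain ⟨w, hw, rfl⟩ := ih hz
        exact ⟨w, hw, by rw [Function.iterate_succ_apply', haltMap_eq_shiftMap hz]⟩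
    exact this.trans (image_mono (subset_univ _))
  · obtain ⟨s, hs⟩ := mem_haltSet_iff.1 he
    obtain ⟨x, -, rfl⟩ := mem_iInter.1 hy (s + 1)
    rw [haltMap_iterate, occursAt_iterate_shiftMap] at h
    exact h.not_of_eraseWords (haltsWithin_mono (by omega) hs)

/-- The points that read `y` up to `p`, followed by `1 0 1`. -/
def separatedCylinder (y : ℕ → Bool) (p : ℕ) : Set (ℕ → Bool) :=
  PiNat.cylinder (glue p y (p + 3) fun _ => true) (p + 3)

/-- Legal prefixes are not altered by erasing words if they are followed by a separator. -/
theorem eraseWords_eq_of_mem {Q : ℕ → ℕ → Prop} (hQ : ∀ i e, Q i e → e ∈ HaltSet)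
    {x y : ℕ → Bool} {n p : ℕ} (hy : y ∈ haltShift)
    (hx : shiftMap^[n] x ∈ separatedCylinder y p) :
    ∀ l < p, eraseWords Q x (l + n) = y l := by
  intro l hl
  have hx' : ∀ i < p + 3, x (i + n) = glue p y (p + 3) (fun _ => true) i := fun i hi => by
    rw [← iterate_shiftMap n x i]
    exact PiNat.mem_cylinder_iff.1 hx i hi
  rw [eraseWords_eq_of_not, hx' l (by omega)]
  · simp [glue, hl]
  · intro e he ho
    rw [← occursAt_iterate_shiftMap] at ho
    have hlt := ho.add_lt_of_separator (p := p) (by simp [iterate_shiftMap, hx' p, glue])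
      (by simp [iterate_shiftMap, hx' (p + 1), glue])
      (by simp [iterate_shiftMap, hx' (p + 2), glue]) hl
    refine hy l e (hQ _ _ he) (ho.congr fun k hk _ => ?_)
    rw [iterate_shiftMap, hx' k (by omega)]
    simp [glue, show k < p by omega]

theorem exists_cylinder_subset {U : Set (ℕ → Bool)} (hU : IsOpen U) {x : ℕ → Bool} (hx : x ∈ U) :
    ∃ n, PiNat.cylinder x n ⊆ U := by
  obtain ⟨s, ⟨y, n, rfl⟩, hxs, hs⟩ :=
    (PiNat.isTopologicalBasis_cylinders fun _ : ℕ => Bool).exists_subset_of_mem_open hx hU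
  refine ⟨n, ?_⟩
  rwa [PiNat.mem_cylinder_iff_eq.1 hxs]

theorem isOpen_setOf_occursAt (e i : ℕ) : IsOpen {x | OccursAt e i x} := by
  refine isOpen_iff_mem_nhds.2 fun x hx => mem_of_superset
    ((PiNat.isOpen_cylinder _ x (i + e + 5)).mem_nhds (PiNat.self_mem_cylinder x _)) fun y hy => ?_
  exact OccursAt.congr hx fun k hk _ => PiNat.mem_cylinder_iff.1 hy k hk

theorem isClosed_haltShift : IsClosed haltShift := by
  have : haltShift = ⋂ i, ⋂ e ∈ HaltSet, {x | OccursAt e i x}ᶜ := by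
    ext x; simp [haltShift]
  rw [this]
  exact isClosed_iInter fun i => isClosed_biInter fun e _ =>
    (isOpen_setOf_occursAt e i).isClosed_compl

theorem continuous_shiftMap : Continuous (shiftMap : (ℕ → Bool) → ℕ → Bool) :=
  continuous_pi fun i => continuous_apply (i + 1)

theorem omegaSet_haltMap_subset (x : ℕ → Bool) : omegaSet haltMap x ⊆ haltShift := by
  intro y hy i e he h
  obtain ⟨s, hs⟩ := mem_haltSet_iff.1 he
  have hf := MapClusterPt.frequently hy ((isOpen_setOf_occursAt e i).mem_nhds h)
  obtain ⟨n, hn, ho⟩ := Filter.frequently_atTop.1 hf (s + 1)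
  have ho : OccursAt e i (haltMap^[n] x) := ho
  rw [haltMap_iterate_of_pos (by omega), occursAt_iterate_shiftMap] at ho
  exact ho.not_of_eraseWords (haltsWithin_mono (by omega) hs)

theorem realm_haltMap : realm haltMap haltShift = univ :=
  eq_univ_of_forall omegaSet_haltMap_subset

theorem stronglyAttracting_haltShift : StronglyAttracting haltMap haltShift :=
  ⟨univ, isOpen_univ, subset_univ _, subset_univ _, haltShift_eq_iInter⟩

theorem iterate_shiftMap_glue {p n : ℕ} (hn : p + 3 ≤ n) (x y : ℕ → Bool) :
    shiftMap^[n] (glue p x n y) = y := by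
  funext k
  simp [iterate_shiftMap, glue]
  omega

theorem glue_mem_cylinder (p n : ℕ) (x y : ℕ → Bool) : glue p x n y ∈ PiNat.cylinder x p :=
  PiNat.mem_cylinder_iff.2 fun i hi => by simp [glue, hi]

theorem mixing_haltShift (U V : Set (ℕ → Bool)) (hV : IsOpen V)
    (hUA : (U ∩ haltShift).Nonempty) (hVA : (V ∩ haltShift).Nonempty) :
    ∃ N : ℕ, ∀ n ≥ N, ((shiftMap^[n] ⁻¹' U) ∩ V ∩ haltShift).Nonempty := by
  obtain ⟨y, hyU, hy⟩ := hUA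
  obtain ⟨x, hxV, hx⟩ := hVA
  obtain ⟨p, hp⟩ := exists_cylinder_subset hV hxV
  refine ⟨p + 3, fun n hn => ⟨glue p x n y, ⟨?_, hp (glue_mem_cylinder p n x y)⟩,
    glue_mem_haltShift hn (fun i e he _ => hx i e he) hy⟩⟩
  rwa [mem_preimage, iterate_shiftMap_glue hn]

theorem isOpen_separatedCylinder (y : ℕ → Bool) (p : ℕ) : IsOpen (separatedCylinder y p) :=
  PiNat.isOpen_cylinder _ _ _

theorem separatedCylinder_nonempty (y : ℕ → Bool) (p : ℕ) : (separatedCylinder y p).Nonempty :=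
  ⟨_, PiNat.self_mem_cylinder _ _⟩

/-- A point whose realm misses a piece of the attractor visits some cylinder only finitely often. -/
theorem eventually_notMem_of_mem_realm {A' : Set (ℕ → Bool)} {y : ℕ → Bool} {p : ℕ}
    (hy : y ∈ haltShift) (hA' : Disjoint (PiNat.cylinder y p) A') {x : ℕ → Bool}
    (hx : x ∈ realm haltMap A') :
    ∃ N, ∀ n ≥ N, shiftMap^[n] x ∉ separatedCylinder y p := by
  by_contra! hc
  have hclosed : IsClosed (PiNat.cylinder y p) := by
    rw [PiNat.cylinder_eq_pi]
    exact isClosed_set_pi fun _ _ => isClosed_discrete _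
  have hfreq : ∃ᶠ n in atTop, haltMap^[n] x ∈ PiNat.cylinder y p := by
    refine frequently_atTop.2 fun N => ?_
    obtain ⟨n, hn, hmem⟩ := hc (N + 1)
    refine ⟨n, by omega, PiNat.mem_cylinder_iff.2 fun i hi => ?_⟩
    rw [haltMap_iterate_of_pos (by omega), iterate_shiftMap]
    exact eraseWords_eq_of_mem (fun _ _ h => h.mem_haltSet) hy hmem i hi
  obtain ⟨z, hz, hcl⟩ := hclosed.isCompact.exists_mapClusterPt_of_frequently hfreq
  exact disjoint_left.1 hA' hz (hx hcl)

theorem exists_cylinder_disjoint {A' : Set (ℕ → Bool)} (hc : IsClosed A') (h : A' ⊂ haltShift) :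
    ∃ y ∈ haltShift, ∃ p, Disjoint (PiNat.cylinder y p) A' := by
  obtain ⟨y, hy, hyA⟩ := exists_of_ssubset h
  obtain ⟨p, hp⟩ := exists_cylinder_subset hc.isOpen_compl hyA
  exact ⟨y, hy, p, disjoint_left.2 fun z hz => hp hz⟩

theorem isMeagre_realm {A' : Set (ℕ → Bool)} (hc : IsClosed A') (h : A' ⊂ haltShift) :
    IsMeagre (realm haltMap A') := by
  obtain ⟨y, hy, p, hp⟩ := exists_cylinder_disjoint hc h
  set S : ℕ → Set (ℕ → Bool) := fun N => {x | ∀ n ≥ N, shiftMap^[n] x ∉ separatedCylinder y p}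
  have hsub : realm haltMap A' ⊆ ⋃ N, S N := fun x hx =>
    mem_iUnion.2 (eventually_notMem_of_mem_realm hy hp hx)
  refine IsMeagre.mono hsub (isMeagre_iUnion fun N => IsNowhereDense.isMeagre ?_)
  have hcl : IsClosed (S N) := by
    have : S N = ⋂ n, ⋂ _ : n ≥ N, (shiftMap^[n] ⁻¹' separatedCylinder y p)ᶜ := by
      ext x; simp [S]
    rw [this]
    exact isClosed_iInter fun n => isClosed_iInter fun _ =>
      ((isOpen_separatedCylinder y p).preimage (continuous_shiftMap.iterate n)).isClosed_compl
  rw [hcl.isNowhereDense_iff, ← not_nonempty_iff_eq_empty]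
  rintro ⟨x, hx⟩
  obtain ⟨m, hm⟩ := exists_cylinder_subset isOpen_interior hx
  obtain ⟨v, hv⟩ := separatedCylinder_nonempty y p
  have hz : glue m x (m + 3 + N) v ∈ S N :=
    interior_subset (hm (glue_mem_cylinder m _ x v))
  refine hz (m + 3 + N) (by omega) ?_
  rwa [iterate_shiftMap_glue (by omega)]

theorem isTopAttractor_haltShift : IsTopAttractor haltMap haltShift := by
  refine ⟨isClosed_haltShift, mapsTo_haltMap_haltShift, ?_, fun A' => isMeagre_realm⟩
  rw [realm_haltMap]
  exact univ_mem

theorem measure_pos_of_measSupport {X : Type*} [TopologicalSpace X] [MeasurableSpace X]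
    {μ : Measure X} (h : measSupport μ = univ) {U : Set X} (hU : IsOpen U) (hne : U.Nonempty) :
    0 < μ U := by
  obtain ⟨x, hx⟩ := hne
  exact (h.symm ▸ mem_univ x : x ∈ measSupport μ) U hU hx

/-- Almost every orbit of an ergodic map visits a set of positive measure infinitely often. -/
theorem Ergodic.ae_frequently_mem {α : Type*} [MeasurableSpace α] {μ : Measure α}
    [IsFiniteMeasure μ] {T : α → α} (hT : Ergodic T μ) {V : Set α} (hV : MeasurableSet V)
    (hpos : 0 < μ V) : ∀ᵐ x ∂μ, ∀ N, ∃ n ≥ N, T^[n] x ∈ V := by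
  have hSm : MeasurableSet (⋃ n, T^[n] ⁻¹' V) :=
    .iUnion fun n => (hT.measurable.iterate n) hV
  have hsub : T ⁻¹' (⋃ n, T^[n] ⁻¹' V) ⊆ ⋃ n, T^[n] ⁻¹' V := by
    rintro x hx
    obtain ⟨n, hn⟩ := mem_iUnion.1 hx
    exact mem_iUnion.2 ⟨n + 1, hn⟩
  have hfull : ∀ᵐ x ∂μ, x ∈ ⋃ n, T^[n] ⁻¹' V := by
    rcases hT.ae_empty_or_univ_of_preimage_ae_le hSm.nullMeasurableSet
      (LE.le.eventuallyLE hsub) with h | h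
    · exact absurd (measure_mono_null (subset_iUnion (fun n => T^[n] ⁻¹' V) 0)
        (measure_congr h |>.trans measure_empty)) hpos.ne'
    · filter_upwards [h] with x hx
      exact hx.mpr trivial
  have hall : ∀ N, ∀ᵐ x ∂μ, T^[N] x ∈ ⋃ n, T^[n] ⁻¹' V := fun N =>
    (hT.toMeasurePreserving.iterate N).quasiMeasurePreserving.ae hfull
  filter_upwards [ae_all_iff.2 hall] with x hx N
  obtain ⟨n, hn⟩ := mem_iUnion.1 (hx N)
  refine ⟨n + N, by omega, ?_⟩
  rw [Function.iterate_add_apply]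
  exact hn

theorem isMetricAttractor_haltShift {lam : Measure (ℕ → Bool)} [IsProbabilityMeasure lam]
    (hlam : Ergodic shiftMap lam) (hsupp : measSupport lam = univ) :
    IsMetricAttractor haltMap lam haltShift := by
  refine ⟨isClosed_haltShift, mapsTo_haltMap_haltShift, ?_, fun A' hc h => ?_⟩
  · rw [realm_haltMap, measure_univ]
  · obtain ⟨y, hy, p, hp⟩ := exists_cylinder_disjoint hc h
    have hV := isOpen_separatedCylinder y p
    have hae := hlam.ae_frequently_mem hV.measurableSet
      (measure_pos_of_measSupport hsupp hV (separatedCylinder_nonempty y p))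
    refine measure_eq_zero_iff_ae_notMem.2 ?_
    filter_upwards [hae] with x hx hxr
    obtain ⟨N, hN⟩ := eventually_notMem_of_mem_realm hy hp hxr
    obtain ⟨n, hn, hmem⟩ := hx N
    exact hN n hn hmem

/-- The sequence whose first even letters are given by `b` and all of whose other letters are
`1`. -/
def interleave {m : ℕ} (b : Fin m → Bool) : ℕ → Bool :=
  fun i => if h : i / 2 < m ∧ i % 2 = 0 then b ⟨i / 2, h.1⟩ else true

theorem interleave_two_mul {m : ℕ} (b : Fin m → Bool) (k : Fin m) :
    interleave b (2 * k) = b k := by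
  simp [interleave]

theorem even_of_interleave_eq_false {m : ℕ} {b : Fin m → Bool} {i : ℕ}
    (h : interleave b i = false) : i % 2 = 0 := by
  by_contra hi
  simp [interleave, hi] at h

theorem interleave_mem_haltShift {m : ℕ} (b : Fin m → Bool) : interleave b ∈ haltShift := by
  rintro i e - ⟨h1, h2, -⟩
  have := even_of_interleave_eq_false h1
  have := even_of_interleave_eq_false h2
  omega

theorem setOf_eq_zero_mem_uniformity :
    {p : (ℕ → Bool) × (ℕ → Bool) | p.1 0 = p.2 0} ∈ uniformity (ℕ → Bool) := by
  have h : {p : Bool × Bool | p.1 = p.2} ∈ uniformity Bool := by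
    rw [discreteUniformity_iff_eq_principal_setRelId.1 inferInstance]
    exact fun p hp => hp
  exact Pi.uniformContinuous_proj (fun _ : ℕ => Bool) 0 h

theorem two_pow_le_netMaxcard (m : ℕ) :
    ((2 ^ m : ℕ) : ℕ∞) ≤ Dynamics.netMaxcard shiftMap haltShift
      {p : (ℕ → Bool) × (ℕ → Bool) | p.1 0 = p.2 0} (2 * m) := by
  have key : ∀ b b' : Fin m → Bool, (∀ k < 2 * m, interleave b k = interleave b' k) → b = b' := by
    intro b b' h
    funext k
    rw [← interleave_two_mul b k, ← interleave_two_mul b' k, h _ (by omega)]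
  have hinj : Function.Injective (interleave : (Fin m → Bool) → ℕ → Bool) :=
    fun b b' h => key b b' fun k _ => congrFun h k
  have hcard : (Finset.univ.map ⟨_, hinj⟩ : Finset (ℕ → Bool)).card = 2 ^ m := by
    simp
  rw [← hcard]
  refine Dynamics.IsDynNetIn.card_le_netMaxcard ⟨?_, ?_⟩
  · intro x hx
    obtain ⟨b, rfl⟩ : ∃ b : Fin m → Bool, interleave b = x := by simpa using hx
    exact interleave_mem_haltShift b
  · intro x hx y hy hxy
    obtain ⟨b, rfl⟩ : ∃ b : Fin m → Bool, interleave b = x := by simpa using hx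
    obtain ⟨b', rfl⟩ : ∃ b : Fin m → Bool, interleave b = y := by simpa using hy
    refine Set.disjoint_left.2 fun z hz hz' => hxy (congrArg _ (key b b' fun k hk => ?_))
    have h1 := Dynamics.mem_ball_dynEntourage.1 hz k hk
    have h2 := Dynamics.mem_ball_dynEntourage.1 hz' k hk
    change shiftMap^[k] (interleave b) 0 = shiftMap^[k] z 0 at h1
    change shiftMap^[k] (interleave b') 0 = shiftMap^[k] z 0 at h2
    simpa [iterate_shiftMap] using h1.trans h2.symm

theorem coverEntropy_haltShift_pos : 0 < Dynamics.coverEntropy shiftMap haltShift := by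
  refine lt_of_lt_of_le ?_
    (Dynamics.netEntropyEntourage_le_coverEntropy shiftMap haltShift setOf_eq_zero_mem_uniformity)
  have h1 : (0 : EReal) < ENNReal.log (5 / 4) := by
    rw [ENNReal.zero_lt_log_iff, ENNReal.lt_div_iff_mul_lt (by norm_num) (by norm_num)]
    norm_num
  refine h1.trans_le ?_
  rw [← ExpGrowth.expGrowthInf_pow]
  refine ExpGrowth.expGrowthInf_le_expGrowthSup_of_frequently_le
    (frequently_atTop.2 fun N => ⟨2 * N, by omega, ?_⟩)
  have h2 : ((5 : ℝ≥0∞) / 4) ^ 2 ≤ 2 := by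
    rw [div_eq_mul_inv, mul_pow, ← ENNReal.inv_pow, ← div_eq_mul_inv,
      ENNReal.div_le_iff (by norm_num) (by norm_num)]
    norm_num
  calc ((5 : ℝ≥0∞) / 4) ^ (2 * N) ≤ 2 ^ N := by
        rw [pow_mul]; gcongr
    _ = (((2 ^ N : ℕ) : ℕ∞) : ℝ≥0∞) := by simp
    _ ≤ _ := ENat.toENNReal_mono (two_pow_le_netMaxcard N)

theorem measurable_eraseWords (Q : ℕ → ℕ → Prop) : Measurable (eraseWords Q) := by
  refine measurable_pi_iff.2 fun i => measurable_to_bool ?_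
  have : (fun x => eraseWords Q x i) ⁻¹' {true} =
      (fun x : ℕ → Bool => x i) ⁻¹' {true} ∪ ⋃ e ∈ {e | Q i e}, {x | OccursAt e i x} := by
    ext x
    simp [eraseWords]
  rw [this]
  exact (measurable_pi_apply i (measurableSet_singleton true)).union
    (MeasurableSet.biUnion (to_countable _) fun e _ => (isOpen_setOf_occursAt e i).measurableSet)

theorem measurable_fullErase : Measurable fullErase := measurable_eraseWords _

theorem measurable_haltMap : Measurable haltMap :=
  continuous_shiftMap.measurable.comp (measurable_eraseWords _)

theorem map_haltMap_map_fullErase {lam : Measure (ℕ → Bool)}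
    (h : MeasurePreserving shiftMap lam lam) :
    (lam.map fullErase).map haltMap = lam.map fullErase := by
  have hc : haltMap ∘ fullErase = fullErase ∘ shiftMap := by
    funext x
    simp [haltMap_eq_shiftMap (fullErase_mem x), fullErase_shiftMap]
  rw [Measure.map_map measurable_haltMap measurable_fullErase, hc,
    ← Measure.map_map measurable_fullErase h.measurable, h.map_eq]

theorem measSupport_map_fullErase {lam : Measure (ℕ → Bool)} (h : measSupport lam = univ) :
    measSupport (lam.map fullErase) = haltShift := by
  refine Subset.antisymm (fun y hy => ?_) fun y hy U hU hyU => ?_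
  · by_contra hyA
    refine (hy _ isClosed_haltShift.isOpen_compl hyA).ne' ?_
    rw [Measure.map_apply measurable_fullErase isClosed_haltShift.measurableSet.compl]
    convert measure_empty (μ := lam)
    ext x
    simp [fullErase_mem]
  · obtain ⟨p, hp⟩ := exists_cylinder_subset hU hyU
    rw [Measure.map_apply measurable_fullErase hU.measurableSet]
    refine (measure_pos_of_measSupport h (isOpen_separatedCylinder y p)
      (separatedCylinder_nonempty y p)).trans_le (measure_mono fun x hx => hp fun l hl => ?_)
    exact eraseWords_eq_of_mem (n := 0) (fun _ _ h => h) hy hx l hl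

/-- The sequences with an occurrence of a forbidden word of index larger than `J` starting before
`p`. -/
def longWordSet (J p : ℕ) : Set (ℕ → Bool) :=
  {x | ∃ k < p, ∃ e ∈ HaltSet, J < e ∧ OccursAt e k x}

theorem measurableSet_longWordSet (J p : ℕ) : MeasurableSet (longWordSet J p) := by
  have : longWordSet J p = ⋃ k ∈ Iio p, ⋃ e ∈ HaltSet ∩ Ioi J, {x | OccursAt e k x} := by
    ext x
    simp only [longWordSet, mem_ofPred_eq, mem_iUnion, mem_Iio, mem_inter_iff, mem_Ioi, exists_prop,
      and_assoc]
  rw [this]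
  exact .biUnion (to_countable _) fun k _ => .biUnion (to_countable _) fun e _ =>
    (isOpen_setOf_occursAt e k).measurableSet

theorem tendsto_measure_longWordSet (lam : Measure (ℕ → Bool)) [IsProbabilityMeasure lam] (p : ℕ) :
    Tendsto (fun J => lam.real (longWordSet J p)) atTop (𝓝 0) := by
  have h : ⋂ J, longWordSet J p = ∅ := by
    refine eq_empty_of_forall_notMem fun x hx => ?_
    have hb : ∀ k, ∃ b, ∀ e, OccursAt e k x → e ≤ b := fun k => by
      by_cases hk : ∃ e, OccursAt e k x
      · obtain ⟨e, he⟩ := hk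
        exact ⟨e, fun e' he' => (he'.unique he).le⟩
      · exact ⟨0, fun e he => absurd ⟨e, he⟩ hk⟩
    choose b hb using hb
    obtain ⟨k, hk, e, -, he, ho⟩ := mem_iInter.1 hx (∑ k ∈ Finset.range p, b k)
    have := Finset.single_le_sum (f := b) (fun _ _ => Nat.zero_le _) (Finset.mem_range.2 hk)
    have := hb k e ho
    omega
  have hm := tendsto_measure_iInter_atTop (μ := lam) (s := fun J => longWordSet J p)
    (fun J => (measurableSet_longWordSet J p).nullMeasurableSet)
    (fun J J' hJ x ⟨k, hk, e, he, hJe, ho⟩ => ⟨k, hk, e, he, hJ.trans_lt hJe, ho⟩)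
    ⟨0, measure_ne_top _ _⟩
  rw [h, measure_empty] at hm
  exact (ENNReal.tendsto_toReal ENNReal.zero_ne_top).comp hm

theorem exists_stage (J : ℕ) : ∃ s, ∀ e ≤ J, e ∈ HaltSet → HaltsWithin s e := by
  have : ∀ e, ∃ s, e ∈ HaltSet → HaltsWithin s e := fun e => by
    by_cases he : e ∈ HaltSet
    · exact (mem_haltSet_iff.1 he).imp fun s hs _ => hs
    · exact ⟨0, fun h => absurd h he⟩
  choose s hs using this
  exact ⟨∑ e ∈ Finset.range (J + 1), s e, fun e he heH => haltsWithin_mono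
    (Finset.single_le_sum (f := s) (fun _ _ => Nat.zero_le _) (Finset.mem_range.2 (by omega)))
    (hs e heH)⟩

theorem stageErase_eq_fullErase {J s p i : ℕ} (hs : ∀ e ≤ J, e ∈ HaltSet → HaltsWithin s e)
    (hi : s ≤ i) {x : ℕ → Bool} (hx : shiftMap^[i] x ∉ longWordSet J p) {k : ℕ} (hk : k < p) :
    stageErase x (i + k) = fullErase x (i + k) := by
  have : (∃ e, HaltsWithin (i + k) e ∧ OccursAt e (i + k) x) ↔
      ∃ e, e ∈ HaltSet ∧ OccursAt e (i + k) x := by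
    refine exists_congr fun e => and_congr_left fun ho => ⟨fun h => h.mem_haltSet, fun h => ?_⟩
    refine haltsWithin_mono (by omega) (hs e (not_lt.1 fun hJ => hx ⟨k, hk, e, h, hJ, ?_⟩) h)
    rwa [occursAt_iterate_shiftMap, Nat.add_comm]
  simp only [stageErase, fullErase, eraseWords]
  exact congrArg _ (decide_eq_decide.2 this)

theorem exists_prefix_close (φ : C(ℕ → Bool, ℝ)) {ε : ℝ} (hε : 0 < ε) :
    ∃ p, ∀ x y : ℕ → Bool, (∀ k < p, x k = y k) → |φ x - φ y| < ε := by
  have h := CompactSpace.uniformContinuous_of_continuous φ.continuous (Metric.dist_mem_uniformity hε)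
  rw [mem_map, Pi.uniformity, discreteUniformity_iff_eq_principal_setRelId.1 inferInstance] at h
  simp only [comap_principal] at h
  obtain ⟨t, ht, h⟩ := (hasBasis_iInf_principal_finite _).mem_iff.1 h
  obtain ⟨p, hp⟩ := ht.bddAbove
  refine ⟨p + 1, fun x y hxy => h (show (x, y) ∈ _ from mem_iInter₂.2 fun k hk => ?_)⟩
  exact hxy k (Nat.lt_succ_of_le (hp hk))

theorem abs_birkhoffAverage_sub_le {X : Type*} {T S : X → X} {φ ψ w : X → ℝ} {ε C : ℝ} {s : ℕ}
    {x : X} (hε : 0 ≤ ε) (hC : ∀ i, |φ (T^[i] x) - ψ (S^[i] x)| ≤ C) (hw : ∀ i, 0 ≤ w (S^[i] x))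
    (h : ∀ i ≥ s, |φ (T^[i] x) - ψ (S^[i] x)| ≤ ε + C * w (S^[i] x)) (n : ℕ) :
    |birkhoffAverage ℝ T φ n x - birkhoffAverage ℝ S ψ n x| ≤
      ε + C * birkhoffAverage ℝ S w n x + s * C / n := by
  have hC0 : 0 ≤ C := (abs_nonneg _).trans (hC 0)
  obtain rfl | hn := n.eq_zero_or_pos
  · simpa using hε
  have hn' : (0 : ℝ) < n := by exact_mod_cast hn
  have hs : ∑ i ∈ Finset.range n, (if i < s then C else 0) ≤ s * C := by
    rw [← Finset.sum_filter, Finset.sum_const, nsmul_eq_mul]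
    gcongr
    calc _ ≤ (Finset.range s).card := Finset.card_le_card fun i hi => by
          simpa using (Finset.mem_filter.1 hi).2
      _ = s := Finset.card_range s
  have key : |∑ i ∈ Finset.range n, (φ (T^[i] x) - ψ (S^[i] x))| ≤
      n * ε + C * ∑ i ∈ Finset.range n, w (S^[i] x) + s * C := by
    calc _ ≤ ∑ i ∈ Finset.range n, |φ (T^[i] x) - ψ (S^[i] x)| := Finset.abs_sum_le_sum_abs _ _
      _ ≤ ∑ i ∈ Finset.range n, (ε + C * w (S^[i] x) + if i < s then C else 0) := by
        refine Finset.sum_le_sum fun i _ => ?_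
        split_ifs with hi
        · have := hC i
          have := mul_nonneg hC0 (hw i)
          linarith
        · simpa using h i (not_lt.1 hi)
      _ ≤ _ := by
        rw [Finset.sum_add_distrib, Finset.sum_add_distrib, ← Finset.mul_sum]
        simpa using hs
  simp only [birkhoffAverage, birkhoffSum, smul_eq_mul]
  rw [← mul_sub, ← Finset.sum_sub_distrib, abs_mul, abs_of_pos (inv_pos.2 hn')]
  calc _ ≤ (n : ℝ)⁻¹ * _ := mul_le_mul_of_nonneg_left key (inv_pos.2 hn').le
    _ = _ := by field_simp

theorem tendsto_birkhoffAverage_haltMap_sub {lam : Measure (ℕ → Bool)} [IsProbabilityMeasure lam]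
    {x : ℕ → Bool} (hx : ∀ J p, Tendsto
      (fun n => birkhoffAverage ℝ shiftMap ((longWordSet J p).indicator 1) n x) atTop
      (𝓝 (lam.real (longWordSet J p)))) (φ : C(ℕ → Bool, ℝ)) :
    Tendsto (fun n => birkhoffAverage ℝ haltMap φ n x -
      birkhoffAverage ℝ shiftMap (φ ∘ fullErase) n x) atTop (𝓝 0) := by
  have hC : ∀ i, |φ (haltMap^[i] x) - (φ ∘ fullErase) (shiftMap^[i] x)| ≤ ‖φ‖ + ‖φ‖ := fun i =>
    (abs_sub _ _).trans (add_le_add (φ.norm_coe_le_norm _) (φ.norm_coe_le_norm _))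
  set C := ‖φ‖ + ‖φ‖
  refine Metric.tendsto_atTop'.2 fun ε hε => ?_
  obtain ⟨p, hp⟩ := exists_prefix_close φ (half_pos hε)
  obtain ⟨J, hJ⟩ : ∃ J, C * lam.real (longWordSet J p) < ε / 2 :=
    (((tendsto_measure_longWordSet lam p).const_mul C).eventually_lt_const
      (by simpa using half_pos hε)).exists
  obtain ⟨s, hs⟩ := exists_stage J
  have hlim : Tendsto (fun n : ℕ => ε / 2 + C * birkhoffAverage ℝ shiftMap
      ((longWordSet J p).indicator 1) n x + ((s + 1 : ℕ) : ℝ) * C / n) atTop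
      (𝓝 (ε / 2 + C * lam.real (longWordSet J p) + 0)) :=
    (((hx J p).const_mul C).const_add _).add (tendsto_const_div_atTop_nhds_zero_nat _)
  obtain ⟨N, hN⟩ := eventually_atTop.1 (hlim.eventually_lt_const (show _ < ε by linarith))
  refine ⟨N, fun n hn => ?_⟩
  rw [Real.dist_0_eq_abs]
  refine (abs_birkhoffAverage_sub_le (half_pos hε).le hC
    (fun i => indicator_nonneg (fun _ _ => zero_le_one) _) (fun i hi => ?_) n).trans_lt (hN n hn.le)
  by_cases hW : shiftMap^[i] x ∈ longWordSet J p
  · rw [indicator_of_mem hW]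
    have := hC i
    simp only [mul_one]
    linarith
  · rw [indicator_of_notMem hW, mul_zero, add_zero]
    refine (hp _ _ fun k hk => ?_).le
    rw [haltMap_iterate_of_pos (by omega), fullErase_iterate_shiftMap, iterate_shiftMap,
      iterate_shiftMap, Nat.add_comm, stageErase_eq_fullErase hs (by omega) hW hk]

theorem integral_empMeasure {X : Type*} [TopologicalSpace X] [CompactSpace X] [MeasurableSpace X]
    [BorelSpace X] (T : X → X) (x : X) (n : ℕ) (φ : C(X, ℝ)) :
    ∫ y, φ y ∂(empMeasure T x n) = birkhoffAverage ℝ T φ n x := by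
  rw [empMeasure, integral_smul_measure, integral_finsetSum_measure]
  · simp [birkhoffAverage, birkhoffSum,
      integral_dirac' _ _ φ.continuous.measurable.stronglyMeasurable]
  · exact fun i _ => Integrable.of_bound φ.continuous.measurable.aestronglyMeasurable ‖φ‖
      (Eventually.of_forall fun x => φ.norm_coe_le_norm _)

theorem abs_birkhoffAverage_sub_le_norm {X Y : Type*} [TopologicalSpace X] [CompactSpace X]
    (S : Y → Y) (h : Y → X) (φ ψ : C(X, ℝ)) (n : ℕ) (y : Y) :
    |birkhoffAverage ℝ S (φ ∘ h) n y - birkhoffAverage ℝ S (ψ ∘ h) n y| ≤ ‖φ - ψ‖ := by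
  have := abs_birkhoffAverage_sub_le (T := S) (S := S) (φ := φ ∘ h) (ψ := ψ ∘ h) (w := 0) (s := 0)
    (x := y) (norm_nonneg (φ - ψ)) (fun i => (φ - ψ).norm_coe_le_norm _) (fun _ => le_rfl)
    (fun i _ => by simpa using (φ - ψ).norm_coe_le_norm _) n
  simpa [birkhoffAverage, birkhoffSum] using this

theorem tendsto_birkhoffAverage_of_denseRange {X : Type*} [TopologicalSpace X] [CompactSpace X]
    [MeasurableSpace X] [BorelSpace X] {μ : Measure X} [IsProbabilityMeasure μ]
    {ι : Type*} {g : ι → C(X, ℝ)}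
    (hg : DenseRange g) {Y : Type*} {S : Y → Y} {h : Y → X} {x : Y}
    (hx : ∀ m, Tendsto (fun n => birkhoffAverage ℝ S (g m ∘ h) n x) atTop (𝓝 (∫ y, g m y ∂μ)))
    (φ : C(X, ℝ)) :
    Tendsto (fun n => birkhoffAverage ℝ S (φ ∘ h) n x) atTop (𝓝 (∫ y, φ y ∂μ)) := by
  refine Metric.tendsto_atTop'.2 fun ε hε => ?_
  obtain ⟨m, hm⟩ := hg.exists_dist_lt φ (show 0 < ε / 3 by linarith)
  rw [dist_eq_norm] at hm
  have hi : ∀ ψ : C(X, ℝ), Integrable ψ μ := fun ψ =>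
    Integrable.of_bound ψ.continuous.measurable.aestronglyMeasurable ‖ψ‖
      (Eventually.of_forall fun x => ψ.norm_coe_le_norm _)
  have h1 : |∫ y, φ y ∂μ - ∫ y, g m y ∂μ| ≤ ‖φ - g m‖ := by
    rw [← integral_sub (hi _) (hi _)]
    simpa using norm_integral_le_of_norm_le_const (μ := μ)
      (Eventually.of_forall fun y => (φ - g m).norm_coe_le_norm y)
  obtain ⟨N, hN⟩ := Metric.tendsto_atTop'.1 (hx m) (ε / 3) (by linarith)
  refine ⟨N, fun n hn => ?_⟩
  have h2 := hN n hn
  have h3 := abs_birkhoffAverage_sub_le_norm S h φ (g m) n x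
  rw [Real.dist_eq] at h2 ⊢
  rw [abs_lt] at h2 ⊢
  rw [abs_le] at h1 h3
  constructor <;> linarith [h1.1, h1.2, h2.1, h2.2, h3.1, h3.2]

theorem ae_weakTendsto_empMeasure {lam : Measure (ℕ → Bool)} [IsProbabilityMeasure lam]
    (hlam : Ergodic shiftMap lam) :
    ∀ᵐ x ∂lam, WeakTendsto (empMeasure haltMap x) (lam.map fullErase) := by
  have : IsProbabilityMeasure (lam.map fullErase) :=
    Measure.isProbabilityMeasure_map measurable_fullErase.aemeasurable
  have h1 : ∀ᵐ x ∂lam, ∀ J p, Tendsto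
      (fun n => birkhoffAverage ℝ shiftMap ((longWordSet J p).indicator 1) n x) atTop
      (𝓝 (lam.real (longWordSet J p))) := by
    refine ae_all_iff.2 fun J => ae_all_iff.2 fun p => ?_
    have := hlam.ae_tendsto_birkhoffAverage
      (measurable_one.indicator (measurableSet_longWordSet J p))
      ((integrable_const (1 : ℝ)).indicator (measurableSet_longWordSet J p))
    rwa [integral_indicator_one (measurableSet_longWordSet J p)] at this
  have h2 : ∀ᵐ x ∂lam, ∀ m, Tendsto (fun n => birkhoffAverage ℝ shiftMap
      (TopologicalSpace.denseSeq C(ℕ → Bool, ℝ) m ∘ fullErase) n x) atTop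
      (𝓝 (∫ y, TopologicalSpace.denseSeq C(ℕ → Bool, ℝ) m y ∂(lam.map fullErase))) := by
    refine ae_all_iff.2 fun m => ?_
    set g := TopologicalSpace.denseSeq C(ℕ → Bool, ℝ) m
    rw [integral_map measurable_fullErase.aemeasurable
      g.continuous.measurable.aestronglyMeasurable]
    refine hlam.ae_tendsto_birkhoffAverage (g.continuous.measurable.comp measurable_fullErase) ?_
    refine Integrable.of_bound
      (g.continuous.measurable.comp measurable_fullErase).aestronglyMeasurable ‖g‖
      (Eventually.of_forall fun x => g.norm_coe_le_norm _)
  filter_upwards [h1, h2] with x hx1 hx2 φ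
  have := (tendsto_birkhoffAverage_haltMap_sub hx1 φ).add
    (tendsto_birkhoffAverage_of_denseRange (TopologicalSpace.denseRange_denseSeq _) hx2 φ)
  simpa [integral_empMeasure] using this

/-- `m` is the code, as a pair, of a rational number in lowest terms. -/
def IsRatCode (m : ℕ) : Prop :=
  0 < m.unpair.2 ∧ ∀ k < m.unpair.2 + 1, ¬ ((m.unpair.1 + 1) / 2 % k = 0 ∧ m.unpair.2 % k = 0) ∨ k = 1

theorem primrecPred_isRatCode : PrimrecPred IsRatCode := by
  have hn : Primrec fun m : ℕ => m.unpair.1 := Primrec.fst.comp Primrec.unpair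
  have hd : Primrec fun m : ℕ => m.unpair.2 := Primrec.snd.comp Primrec.unpair
  have hR : PrimrecRel fun k m : ℕ =>
      ¬ ((m.unpair.1 + 1) / 2 % k = 0 ∧ m.unpair.2 % k = 0) ∨ k = 1 := by
    refine PrimrecPred.or (PrimrecPred.not (PrimrecPred.and ?_ ?_)) ?_
    · exact Primrec.eq.comp (Primrec.nat_mod.comp
        (Primrec.nat_div.comp (Primrec.succ.comp (hn.comp Primrec.snd)) (Primrec.const 2))
        Primrec.fst) (Primrec.const 0)
    · exact Primrec.eq.comp (Primrec.nat_mod.comp (hd.comp Primrec.snd) Primrec.fst)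
        (Primrec.const 0)
    · exact Primrec.eq.comp Primrec.fst (Primrec.const 1)
  exact (Primrec.nat_lt.comp (Primrec.const 0) hd).and
    (hR.forall_lt.comp (Primrec.succ.comp hd) Primrec.id)

theorem natAbs_eq_intEquivNat (z : ℤ) : z.natAbs = (Equiv.intEquivNat z + 1) / 2 := by
  cases z with
  | ofNat n => change n = (2 * n + 1) / 2; omega
  | negSucc n => change n + 1 = (2 * n + 1 + 1) / 2; omega

theorem coprime_iff_forall_mod {a d : ℕ} (hd : 0 < d) :
    a.Coprime d ↔ ∀ k < d + 1, ¬ (a % k = 0 ∧ d % k = 0) ∨ k = 1 := by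
  refine ⟨fun h k _ => or_iff_not_imp_left.2 fun hk => ?_, fun h => ?_⟩
  · obtain ⟨h1, h2⟩ := not_not.1 hk
    exact Nat.dvd_one.1 (h ▸ Nat.dvd_gcd (Nat.dvd_of_mod_eq_zero h1) (Nat.dvd_of_mod_eq_zero h2))
  · refine (h (a.gcd d) (Nat.lt_succ_of_le (Nat.gcd_le_right _ hd))).resolve_left (not_not.2 ?_)
    exact ⟨Nat.mod_eq_zero_of_dvd (Nat.gcd_dvd_left _ _), Nat.mod_eq_zero_of_dvd (Nat.gcd_dvd_right _ _)⟩

/-- The code of a rational number as a numerator-denominator pair. -/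
def ratCode (a : ℚ) : ℕ := Nat.pair (Equiv.intEquivNat a.num) a.den

theorem mem_range_ratCode {m : ℕ} : m ∈ range ratCode ↔ IsRatCode m := by
  refine ⟨?_, fun ⟨h1, h2⟩ => ?_⟩
  · rintro ⟨a, rfl⟩
    rw [IsRatCode, ← coprime_iff_forall_mod (by simpa [ratCode] using a.den_pos)]
    simpa [ratCode, ← natAbs_eq_intEquivNat] using ⟨a.den_pos, a.reduced⟩
  · rw [← coprime_iff_forall_mod h1] at h2
    refine ⟨⟨Equiv.intEquivNat.symm m.unpair.1, m.unpair.2, h1.ne', ?_⟩, ?_⟩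
    · rwa [natAbs_eq_intEquivNat, Equiv.apply_symm_apply]
    · simp [ratCode]

open Classical in
theorem encode_rat (a : ℚ) :
    @Encodable.encode ℚ Primcodable.toEncodable a = ((List.range (ratCode a)).filter fun m => IsRatCode m).length := by
  rw [← List.countP_eq_length_filter]
  have : (fun m => decide (IsRatCode m)) =
      fun m => @decide (m ∈ range ratCode) (Encodable.decidableRangeEncode ℚ m) :=
    funext fun m => decide_eq_decide.2 mem_range_ratCode.symm
  rw [this]
  rfl

theorem primrecRel_eq_ratCode : PrimrecRel fun (m : ℕ) (a : ℚ) => m = ratCode a := by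
  classical
  have hr : Primrec fun m : ℕ => ((List.range m).filter fun m => IsRatCode m).length :=
    Primrec.list_length.comp ((Primrec.listFilter primrecPred_isRatCode).comp Primrec.list_range)
  refine PrimrecPred.of_eq (PrimrecPred.and (primrecPred_isRatCode.comp Primrec.fst)
    (Primrec.eq.comp (hr.comp Primrec.fst) (Primrec.encode.comp Primrec.snd))) ?_
  rintro ⟨m, a⟩
  refine ⟨fun ⟨hm, h⟩ => ?_, ?_⟩
  · obtain ⟨b, rfl⟩ := mem_range_ratCode.2 hm
    rw [← encode_rat] at h
    exact congrArg ratCode (@Encodable.encode_injective ℚ Primcodable.toEncodable _ _ h)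
  · intro h
    obtain rfl : m = ratCode a := h
    exact ⟨mem_range_ratCode.1 ⟨a, rfl⟩, (encode_rat a).symm⟩

theorem unpair_fst_ratCode_mod_two (a : ℚ) : (ratCode a).unpair.1 % 2 = 0 ↔ 0 ≤ a := by
  rw [← Rat.num_nonneg, ratCode, Nat.unpair_pair]
  cases a.num with
  | ofNat n => change 2 * n % 2 = 0 ↔ _; simp
  | negSucc n => change (2 * n + 1) % 2 = 0 ↔ _; simp

theorem eq_unpair_ratCode_div {a : ℚ} (ha : 0 ≤ a) :
    a = (((ratCode a).unpair.1 / 2 : ℕ) : ℚ) / ((ratCode a).unpair.2 : ℕ) := by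
  rw [ratCode, Nat.unpair_pair]
  conv_lhs => rw [← Rat.num_div_den a]
  congr 1
  rw [← Rat.num_nonneg] at ha
  generalize a.num = z at ha
  lift z to ℕ using ha
  change _ = ((2 * z / 2 : ℕ) : ℚ)
  simp

/-- Positivity of both terms and `1 < a + b` is semidecidable. -/
theorem exists_primrecRel_one_lt_add : ∃ R : ℕ → ℚ × ℚ → Prop, PrimrecRel R ∧
    ∀ p : ℚ × ℚ, (∃ m, R m p) ↔ 0 ≤ p.1 ∧ 0 ≤ p.2 ∧ 1 < p.1 + p.2 := by
  have hn : Primrec fun m : ℕ => m.unpair.1 := Primrec.fst.comp Primrec.unpair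
  have hd : Primrec fun m : ℕ => m.unpair.2 := Primrec.snd.comp Primrec.unpair
  have hm : PrimrecPred fun m : ℕ => m.unpair.1 % 2 = 0 :=
    Primrec.eq.comp (Primrec.nat_mod.comp hn (Primrec.const 2)) (Primrec.const 0)
  have hh : Primrec fun m : ℕ => m.unpair.1 / 2 := Primrec.nat_div.comp hn (Primrec.const 2)
  let L : ℕ × ℕ → Prop := fun m => m.1.unpair.2 * m.2.unpair.2 <
    m.1.unpair.1 / 2 * m.2.unpair.2 + m.2.unpair.1 / 2 * m.1.unpair.2
  have hL : PrimrecPred L := Primrec.nat_lt.comp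
    (Primrec.nat_mul.comp (hd.comp Primrec.fst) (hd.comp Primrec.snd))
    (Primrec.nat_add.comp (Primrec.nat_mul.comp (hh.comp Primrec.fst) (hd.comp Primrec.snd))
      (Primrec.nat_mul.comp (hh.comp Primrec.snd) (hd.comp Primrec.fst)))
  refine ⟨fun m p => (m.unpair.1 = ratCode p.1 ∧ m.unpair.2 = ratCode p.2) ∧
    (m.unpair.1.unpair.1 % 2 = 0 ∧ m.unpair.2.unpair.1 % 2 = 0) ∧ L m.unpair,
    PrimrecPred.and (PrimrecPred.and ?_ ?_) (PrimrecPred.and (PrimrecPred.and ?_ ?_) ?_), ?_⟩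
  · exact primrecRel_eq_ratCode.comp (hn.comp Primrec.fst) (Primrec.fst.comp Primrec.snd)
  · exact primrecRel_eq_ratCode.comp (hd.comp Primrec.fst) (Primrec.snd.comp Primrec.snd)
  · exact hm.comp (hn.comp Primrec.fst)
  · exact hm.comp (hd.comp Primrec.fst)
  · exact hL.comp (Primrec.unpair.comp Primrec.fst)
  rintro ⟨a, b⟩
  have key : (∃ m : ℕ, (m.unpair.1 = ratCode a ∧ m.unpair.2 = ratCode b) ∧
      (m.unpair.1.unpair.1 % 2 = 0 ∧ m.unpair.2.unpair.1 % 2 = 0) ∧ L m.unpair) ↔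
      (0 ≤ a ∧ 0 ≤ b) ∧ L (ratCode a, ratCode b) := by
    simp only [← unpair_fst_ratCode_mod_two]
    refine ⟨?_, fun h => ⟨Nat.pair (ratCode a) (ratCode b), by simpa using h⟩⟩
    rintro ⟨m, ⟨h1, h2⟩, h⟩
    rw [← Prod.mk.eta (p := m.unpair), h1, h2] at h
    exact h
  refine key.trans ?_
  rw [and_assoc]
  refine and_congr_right fun ha => and_congr_right fun hb => ?_
  have h1 : (0 : ℚ) < ((ratCode a).unpair.2 : ℕ) := by
    exact_mod_cast (mem_range_ratCode.1 ⟨a, rfl⟩).1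
  have h2 : (0 : ℚ) < ((ratCode b).unpair.2 : ℕ) := by
    exact_mod_cast (mem_range_ratCode.1 ⟨b, rfl⟩).1
  conv_rhs =>
    rw [eq_unpair_ratCode_div ha, eq_unpair_ratCode_div hb, div_add_div _ _ h1.ne' h2.ne',
      lt_div_iff₀ (by positivity), one_mul, mul_comm (((ratCode a).unpair.2 : ℕ) : ℚ) (_ / _ : ℕ)]
  exact_mod_cast Iff.rfl

theorem PrimrecRel.exists_lt' {α : Type*} [Primcodable α] {R : ℕ → α → Prop} (hR : PrimrecRel R) :
    PrimrecRel fun n a => ∃ k < n, R k a :=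
  (hR.exists_mem_list.comp (Primrec.list_range.comp Primrec.fst) Primrec.snd).of_eq (by simp)

theorem PrimrecRel.forall_lt' {α : Type*} [Primcodable α] {R : ℕ → α → Prop} (hR : PrimrecRel R) :
    PrimrecRel fun n a => ∀ k < n, R k a :=
  (hR.forall_mem_list.comp (Primrec.list_range.comp Primrec.fst) Primrec.snd).of_eq (by simp)

/-- The word `0 0 1^(e+1) 0 0` occurs in the finite word `l` at position `i`. -/
def ListOccursAt (e i : ℕ) (l : List Bool) : Prop :=
  l[i]? = some false ∧ l[i + 1]? = some false ∧ (∀ k < e + 1, l[i + 2 + k]? = some true) ∧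
    l[i + e + 3]? = some false ∧ l[i + e + 4]? = some false

/-- The word `0 0 1^(e+1) 0 0`. -/
def haltWord (e : ℕ) : List Bool :=
  false :: false :: ((List.range (e + 1)).map (fun _ => true) ++ [false, false])

theorem ListOccursAt.add_lt_length {e i : ℕ} {l : List Bool} (h : ListOccursAt e i l) :
    i + e + 4 < l.length :=
  (List.getElem?_eq_some_iff.1 h.2.2.2.2).1

theorem primrecPred_listOccursAt :
    PrimrecPred fun p : ℕ × ℕ × List Bool => ListOccursAt p.1 p.2.1 p.2.2 := by
  have he : Primrec fun p : ℕ × ℕ × List Bool => p.1 := Primrec.fst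
  have hi : Primrec fun p : ℕ × ℕ × List Bool => p.2.1 := Primrec.fst.comp Primrec.snd
  have hl : Primrec fun p : ℕ × ℕ × List Bool => p.2.2 := Primrec.snd.comp Primrec.snd
  have hget : ∀ {f : ℕ × ℕ × List Bool → ℕ} (b : Bool), Primrec f →
      PrimrecPred fun p : ℕ × ℕ × List Bool => p.2.2[f p]? = some b := fun b hf =>
    Primrec.eq.comp (Primrec.list_getElem?.comp hl hf) (Primrec.const _)
  have hR : PrimrecRel fun (k : ℕ) (p : ℕ × List Bool) => p.2[p.1 + 2 + k]? = some true :=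
    (hget (f := fun p => p.2.1 + 2 + p.1) true
      (Primrec.nat_add.comp (Primrec.nat_add.comp hi (Primrec.const 2)) he))
  have hadd : ∀ {c : ℕ}, Primrec fun p : ℕ × ℕ × List Bool => p.2.1 + p.1 + c := fun {c} =>
    Primrec.nat_add.comp (Primrec.nat_add.comp hi he) (Primrec.const c)
  exact (hget false hi).and ((hget false (Primrec.succ.comp hi)).and
    ((hR.forall_lt'.comp (Primrec.succ.comp he) Primrec.snd).and
      ((hget false hadd).and (hget false hadd))))

theorem primrecRel_haltsWithin : PrimrecRel HaltsWithin :=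
  PrimrecPred.and (Primrec.nat_le.comp Primrec.snd Primrec.fst)
    (Primrec.eq.comp (Primrec.option_isSome.comp (Nat.Partrec.Code.primrec_evaln.comp
      ((Primrec.fst.pair ((Primrec.ofNat Nat.Partrec.Code).comp Primrec.snd)).pair
        (Primrec.const 0)))) (Primrec.const true))

theorem primrec_haltWord : Primrec haltWord :=
  Primrec.list_cons.comp (Primrec.const false) (Primrec.list_cons.comp (Primrec.const false)
    (Primrec.list_append.comp (Primrec.list_map (Primrec.list_range.comp Primrec.succ)
      (Primrec.const true).to₂) (Primrec.const [false, false])))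

theorem listOccursAt_iff {e i : ℕ} {l : List Bool} {x : ℕ → Bool}
    (h : ∀ k < i + e + 5, l[k]? = some (x k)) : ListOccursAt e i l ↔ OccursAt e i x := by
  rw [ListOccursAt, OccursAt, h _ (by omega), h _ (by omega), h _ (by omega), h _ (by omega)]
  simp only [Option.some.injEq]
  refine and_congr_right fun _ => and_congr_right fun _ => and_congr_left fun _ =>
    forall₂_congr fun k hk => ?_
  rw [h _ (by omega), Option.some.injEq]

theorem getElem?_eq_of_mem_cyl {w : List Bool} {x : ℕ → Bool} (hx : x ∈ cyl w) {k : ℕ}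
    (hk : k < w.length) : w[k]? = some (x k) := by
  rw [List.getElem?_eq_getElem hk, hx ⟨k, hk⟩]
  rfl

theorem ListOccursAt.occursAt {e i : ℕ} {w : List Bool} (h : ListOccursAt e i w) {x : ℕ → Bool}
    (hx : x ∈ cyl w) : OccursAt e i x :=
  (listOccursAt_iff fun _ hk => getElem?_eq_of_mem_cyl hx
    (by have := h.add_lt_length; omega)).1 h

theorem cyl_inter_haltShift_nonempty_iff {w : List Bool} :
    (cyl w ∩ haltShift).Nonempty ↔ ∀ e ∈ HaltSet, ∀ i, ¬ ListOccursAt e i w := by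
  refine ⟨fun ⟨x, hx, hxA⟩ e he i h => hxA i e he (h.occursAt hx), fun h => ?_⟩
  have hw : (fun k => w[k]?.getD true) ∈ cyl w := fun k => by simp
  refine ⟨_, fun k => ?_, glue_mem_haltShift (p := w.length) (n := w.length + 3)
    (x := fun k => w[k]?.getD true) le_rfl (fun i e he hl ho => h e he i ?_)
    const_true_mem_haltShift⟩
  · rw [← hw k]
    exact if_pos k.2
  · exact (listOccursAt_iff fun _ hk => getElem?_eq_of_mem_cyl hw (by omega)).2 ho

theorem length_haltWord (e : ℕ) : (haltWord e).length = e + 5 := by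
  simp [haltWord]

theorem haltWord_getElem? {e k : ℕ} (hk : k < e + 5) :
    (haltWord e)[k]? = some (decide (2 ≤ k ∧ k < e + 3)) := by
  match k with
  | 0 => simp [haltWord]
  | 1 => simp [haltWord]
  | k + 2 =>
    simp only [haltWord, List.getElem?_cons_succ]
    rcases lt_or_ge k (e + 1) with h | h
    · rw [List.getElem?_append_left (by simpa using h)]
      simp [h]
    · rw [List.getElem?_append_right (by simpa using h)]
      simp only [List.length_map, List.length_range]
      obtain h | h : k - (e + 1) = 0 ∨ k - (e + 1) = 1 := by omega
      all_goals
        rw [h]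
        simp
        omega

theorem listOccursAt_haltWord (e : ℕ) : ListOccursAt e 0 (haltWord e) := by
  refine (listOccursAt_iff fun k hk => haltWord_getElem? (by omega)).2 ⟨?_, ?_, fun k hk => ?_, ?_, ?_⟩
  all_goals simp
  omega

theorem ListOccursAt.eq_of_haltWord {e e' i : ℕ} (h : ListOccursAt e' i (haltWord e)) :
    e' = e := by
  have hl := h.add_lt_length
  rw [length_haltWord] at hl
  have h0 := (listOccursAt_iff fun k hk => haltWord_getElem? (by omega)).1 h
  obtain ⟨-, h2, -, h4, -⟩ := h0
  simp only [decide_eq_false_iff_not] at h2 h4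
  omega

theorem haltWord_mem_iff {e : ℕ} : (cyl (haltWord e) ∩ haltShift).Nonempty ↔ e ∉ HaltSet := by
  rw [cyl_inter_haltShift_nonempty_iff]
  refine ⟨fun h he => h e he 0 (listOccursAt_haltWord e), fun he e' he' i h => he ?_⟩
  rwa [← h.eq_of_haltWord]

open Classical in
theorem cantorComputable_haltMap : CantorComputable haltMap := by
  refine ⟨fun n => 2 * n + 6, fun n l => l[n + 1]?.getD false ||
    decide (∃ e < n + 2, HaltsWithin (n + 1) e ∧ ListOccursAt e (n + 1) l), ?_, ?_, fun x n => ?_⟩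
  · exact (Primrec.nat_add.comp (Primrec.nat_mul.comp (Primrec.const 2) Primrec.id)
      (Primrec.const 6)).to_comp
  · have hR : PrimrecRel fun (e : ℕ) (p : ℕ × List Bool) =>
        HaltsWithin (p.1 + 1) e ∧ ListOccursAt e (p.1 + 1) p.2 := by
      have hs : Primrec fun p : ℕ × ℕ × List Bool => p.2.1 + 1 :=
        Primrec.succ.comp (Primrec.fst.comp Primrec.snd)
      exact PrimrecPred.and (primrecRel_haltsWithin.comp hs Primrec.fst)
        (primrecPred_listOccursAt.comp
          (Primrec.fst.pair (hs.pair (Primrec.snd.comp Primrec.snd))))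
    refine Primrec.to_comp (Primrec.or.comp ?_ (PrimrecPred.decide ?_))
    · exact Primrec.option_getD.comp (Primrec.list_getElem?.comp Primrec.snd
        (Primrec.succ.comp Primrec.fst)) (Primrec.const false)
    · exact hR.exists_lt'.comp (Primrec.succ.comp (Primrec.succ.comp Primrec.fst)) Primrec.id
  · have hget : ∀ k < 2 * n + 7, (List.ofFn fun i : Fin (2 * n + 6 + 1) => x i)[k]? =
        some (x k) := fun k hk => by
      rw [List.getElem?_ofFn, dif_pos hk]
    have hiff : (∃ e, HaltsWithin (n + 1) e ∧ OccursAt e (n + 1) x) ↔ ∃ e < n + 2,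
        HaltsWithin (n + 1) e ∧
          ListOccursAt e (n + 1) (List.ofFn fun i : Fin (2 * n + 6 + 1) => x i) := by
      constructor
      · rintro ⟨e, he, ho⟩
        have := he.1
        exact ⟨e, by omega, he, (listOccursAt_iff fun k hk => hget k (by omega)).2 ho⟩
      · rintro ⟨e, hlt, he, ho⟩
        exact ⟨e, he, (listOccursAt_iff fun k hk => hget k (by omega)).1 ho⟩
    change (x (n + 1) || decide _) = (_ || decide _)
    rw [hget _ (by omega)]
    exact congrArg _ (decide_eq_decide.2 hiff)

open Classical in
theorem piOne_haltShift : PiOne {w : List Bool | (cyl w ∩ haltShift).Nonempty} := by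
  refine ⟨fun p => decide (∃ i < p.2, ∃ e < p.2, HaltsWithin p.2 e ∧ ListOccursAt e i p.1), ?_,
    fun w => ?_⟩
  · have hR : PrimrecRel fun (e : ℕ) (q : ℕ × List Bool × ℕ) =>
        HaltsWithin q.2.2 e ∧ ListOccursAt e q.1 q.2.1 := by
      refine PrimrecPred.and (primrecRel_haltsWithin.comp
        (Primrec.snd.comp (Primrec.snd.comp Primrec.snd)) Primrec.fst)
        (primrecPred_listOccursAt.comp (Primrec.fst.pair ((Primrec.fst.comp Primrec.snd).pair
          (Primrec.fst.comp (Primrec.snd.comp Primrec.snd)))))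
    have hR2 : PrimrecRel fun (i : ℕ) (p : List Bool × ℕ) =>
        ∃ e < p.2, HaltsWithin p.2 e ∧ ListOccursAt e i p.1 :=
      hR.exists_lt'.comp (Primrec.snd.comp Primrec.snd) Primrec.id
    exact (PrimrecPred.decide (hR2.exists_lt'.comp Primrec.snd Primrec.id)).to_comp
  · rw [mem_compl_iff, mem_ofPred_eq, cyl_inter_haltShift_nonempty_iff]
    push Not
    simp only [decide_eq_true_eq]
    constructor
    · rintro ⟨e, he, i, ho⟩
      obtain ⟨s, hs⟩ := mem_haltSet_iff.1 he
      exact ⟨s + i + e + 1, i, by omega, e, by omega, haltsWithin_mono (by omega) hs, ho⟩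
    · rintro ⟨a, i, -, e, -, he, ho⟩
      exact ⟨e, he.mem_haltSet, i, ho⟩

theorem manyOneReducible_haltShift :
    (fun e : ℕ => e ∉ HaltSet) ≤₀ fun w : List Bool => (cyl w ∩ haltShift).Nonempty :=
  ⟨haltWord, primrec_haltWord.to_comp, fun _ => haltWord_mem_iff.symm⟩

theorem isOpen_cyl (w : List Bool) : IsOpen (cyl w) := by
  have : cyl w = ⋂ i : Fin w.length, {x : ℕ → Bool | x i = w.get i} := by
    ext x
    simp [cyl]
  rw [this]
  refine isOpen_iInter_of_finite fun i => ?_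
  have hc : Continuous fun x : ℕ → Bool => x i := continuous_apply _
  exact (isOpen_discrete {w.get i}).preimage hc

theorem measure_pos_iff_inter_measSupport_nonempty {X : Type*} [TopologicalSpace X]
    [SecondCountableTopology X] [MeasurableSpace X] {μ : Measure X} {U : Set X} (hU : IsOpen U) :
    0 < μ U ↔ (U ∩ measSupport μ).Nonempty := by
  refine ⟨fun h => ?_, fun ⟨x, hx, hxμ⟩ => hxμ U hU hx⟩
  by_contra hne
  refine h.ne' (measure_null_of_locally_null U fun x hx => ?_)
  have hxμ : x ∉ measSupport μ := fun hxμ => hne ⟨x, hx, hxμ⟩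
  simp only [measSupport, mem_ofPred_eq, not_forall, not_lt, nonpos_iff_eq_zero] at hxμ
  obtain ⟨V, hV, hxV, h0⟩ := hxμ
  exact ⟨V, mem_nhdsWithin_of_mem_nhds (hV.mem_nhds hxV), h0⟩

theorem exists_rat_add_iff {u v : ℕ → ℚ} {a b : ℝ} (ha : 0 < a) (hb : 0 < b)
    (hu : a = ⨆ k, (u k : ℝ)) (hv : b = ⨆ k, (v k : ℝ)) :
    (∃ k k', 0 ≤ u k ∧ 0 ≤ v k' ∧ 1 < u k + v k') ↔ 1 < a + b := by
  have hbdd : ∀ {u : ℕ → ℚ} {a : ℝ}, 0 < a → a = ⨆ k, (u k : ℝ) →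
      BddAbove (range fun k => (u k : ℝ)) := fun ha hu => by
    by_contra h
    rw [Real.iSup_of_not_bddAbove h] at hu
    exact ha.ne' hu
  constructor
  · rintro ⟨k, k', -, -, h⟩
    have h1 : (u k : ℝ) ≤ a := hu ▸ le_ciSup (hbdd ha hu) k
    have h2 : (v k' : ℝ) ≤ b := hv ▸ le_ciSup (hbdd hb hv) k'
    have h3 : (1 : ℝ) < u k + v k' := by exact_mod_cast h
    linarith
  · intro h
    obtain ⟨k, hk⟩ := exists_lt_of_lt_ciSup (hu ▸ max_lt ha (by linarith : 1 - b < a))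
    obtain ⟨hk0, hk1⟩ := max_lt_iff.1 hk
    obtain ⟨k', hk'⟩ := exists_lt_of_lt_ciSup (hv ▸ max_lt hb (by linarith : 1 - (u k : ℝ) < b))
    obtain ⟨hk0', hk1'⟩ := max_lt_iff.1 hk'
    refine ⟨k, k', by exact_mod_cast hk0.le, by exact_mod_cast hk0'.le, ?_⟩
    have : (1 : ℝ) < u k + v k' := by linarith
    exact_mod_cast this

theorem mem_cyl_singleton {b : Bool} {x : ℕ → Bool} : x ∈ cyl [b] ↔ x 0 = b := by
  simp [cyl]

theorem measureReal_cyl_add {μ : Measure (ℕ → Bool)} [IsProbabilityMeasure μ] (e : ℕ) :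
    μ.real (⋃ w ∈ [haltWord e, [true]], cyl w) + μ.real (⋃ w ∈ [[false]], cyl w) =
      1 + μ.real (cyl (haltWord e)) := by
  have h1 : (⋃ w ∈ [haltWord e, [true]], cyl w) = cyl (haltWord e) ∪ cyl [true] := by
    ext x; simp
  have h2 : (⋃ w ∈ [[false]], cyl w) = (cyl [true])ᶜ := by
    ext x; simp [mem_cyl_singleton]
  have hd : Disjoint (cyl (haltWord e)) (cyl [true]) := by
    refine disjoint_left.2 fun x hx hx' => ?_
    have h0 := (listOccursAt_haltWord e).occursAt hx
    exact Bool.false_ne_true (h0.1.symm.trans (mem_cyl_singleton.1 hx'))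
  rw [h1, h2, measureReal_union hd (isOpen_cyl _).measurableSet,
    probReal_compl_eq_one_sub (isOpen_cyl _).measurableSet]
  ring

theorem rePred_exists {α : Type*} [Primcodable α] {f : α → ℕ → Bool} (hf : Computable₂ f) :
    REPred fun a => ∃ n, f a n = true := by
  refine (Partrec.rfind hf.partrec₂).dom_re.of_eq fun a => Nat.rfind_dom'.trans ?_
  exact exists_congr fun n => ⟨fun h => (Part.mem_some_iff.1 h.1).symm,
    fun h => ⟨Part.mem_some_iff.2 h.symm, fun _ => trivial⟩⟩

theorem not_computableCantorMeasure {μ : Measure (ℕ → Bool)} [IsProbabilityMeasure μ]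
    (hμ : measSupport μ = haltShift) : ¬ ComputableCantorMeasure μ := by
  classical
  rintro ⟨q, hq, h⟩
  obtain ⟨R, hR, hRq⟩ := exists_primrecRel_one_lt_add
  have hpos : ∀ W : List (List Bool), ∀ w ∈ W, (cyl w ∩ haltShift).Nonempty →
      0 < μ.real (⋃ w ∈ W, cyl w) := fun W w hw hne => by
    rw [← hμ, ← measure_pos_iff_inter_measSupport_nonempty (isOpen_cyl w)] at hne
    exact ENNReal.toReal_pos (hne.trans_le (measure_mono (subset_biUnion_of_mem hw))).ne'
      (measure_ne_top _ _)
  have hlen : ∀ b : Bool, (cyl [b] ∩ haltShift).Nonempty := fun b =>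
    cyl_inter_haltShift_nonempty_iff.2 fun e _ i ho => by simpa using ho.add_lt_length
  have key : ∀ e, (∃ k k', 0 ≤ q ([haltWord e, [true]], k) ∧ 0 ≤ q ([[false]], k') ∧
      1 < q ([haltWord e, [true]], k) + q ([[false]], k')) ↔ e ∉ HaltSet := fun e => by
    rw [exists_rat_add_iff (hpos _ [true] (by simp) (hlen _)) (hpos _ [false] (by simp) (hlen _))
      (h _) (h _), measureReal_cyl_add, ← haltWord_mem_iff, ← hμ,
      ← measure_pos_iff_inter_measSupport_nonempty (isOpen_cyl _), lt_add_iff_pos_right,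
      Measure.real, ENNReal.toReal_pos_iff, and_iff_left (measure_lt_top _ _)]
  refine ComputablePred.halting_problem_not_re 0 (REPred.of_eq
    (p := fun c => ∃ n : ℕ, decide (R n.unpair.1
      (q ([haltWord (Encodable.encode c), [true]], n.unpair.2.unpair.1),
        q ([[false]], n.unpair.2.unpair.2))) = true) (rePred_exists ?_) fun c => ?_)
  · have hn : Primrec fun p : Nat.Partrec.Code × ℕ => p.2.unpair.2 :=
      Primrec.snd.comp (Primrec.unpair.comp Primrec.snd)
    refine hR.decide.to_comp.comp
      (Primrec.fst.comp (Primrec.unpair.comp Primrec.snd)).to_comp ((hq.comp ?_).pair (hq.comp ?_))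
    · refine (Primrec.pair (Primrec.list_cons.comp (primrec_haltWord.comp
        (Primrec.encode.comp Primrec.fst)) (Primrec.const [[true]]))
        (Primrec.fst.comp (Primrec.unpair.comp hn))).to_comp
    · exact (Primrec.pair (Primrec.const [[false]])
        (Primrec.snd.comp (Primrec.unpair.comp hn))).to_comp
  · have hc : (Encodable.encode c ∉ HaltSet) ↔ ¬ (c.eval 0).Dom := by
      simp [HaltSet]
    rw [← hc, ← key]
    simp only [decide_eq_true_eq, ← hRq (_, _)]
    constructor
    · rintro ⟨n, hn⟩
      exact ⟨_, _, _, hn⟩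
    · rintro ⟨k, k', m, hm⟩
      exact ⟨Nat.pair m (Nat.pair k k'), by simpa using hm⟩

/-- A Π₁-complete strong attractor: a computable map of the Cantor space `{0,1}^ℕ` with a
closed invariant set `A` which is Π₁-complete, on which `T` acts as the topologically mixing
positive-entropy shift, which is strongly attracting with realm the whole space, and which is a
topological, metric and statistical attractor (w.r.t. any shift-ergodic fully supported
reference measure); the corresponding physical measure is non-computable. -/
theorem stmt11 :
    ∃ (T : (ℕ → Bool) → (ℕ → Bool)) (A : Set (ℕ → Bool)),
      CantorComputable T ∧ IsClosed A ∧ Set.MapsTo T A A ∧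
      -- (i) the inner collection is Π₁ and complete for Π₁
      PiOne {w : List Bool | (cyl w ∩ A).Nonempty} ∧
      ((fun e : ℕ => e ∉ HaltSet) ≤₀ fun w : List Bool => (cyl w ∩ A).Nonempty) ∧
      -- (ii) T is the shift on A, which is mixing with positive topological entropy
      Set.MapsTo shiftMap A A ∧ (∀ x ∈ A, T x = shiftMap x) ∧
      (∀ U V : Set (ℕ → Bool), IsOpen U → IsOpen V →
        (U ∩ A).Nonempty → (V ∩ A).Nonempty →
        ∃ N : ℕ, ∀ n ≥ N, ((shiftMap^[n] ⁻¹' U) ∩ V ∩ A).Nonempty) ∧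
      0 < Dynamics.coverEntropy shiftMap A ∧
      -- (iii) strong attraction, with realm of attraction the whole space
      (A = ⋂ n : ℕ, T^[n] '' Set.univ) ∧
      StronglyAttracting T A ∧
      (∀ x : ℕ → Bool, omegaSet T x ⊆ A) ∧
      -- (iv) A is a topological, metric and statistical attractor; the physical measure is
      -- not computable
      IsTopAttractor T A ∧
      (∀ lam : Measure (ℕ → Bool), IsProbabilityMeasure lam → Ergodic shiftMap lam →
        measSupport lam = Set.univ →
        IsMetricAttractor T lam A ∧
        ∃ μ : Measure (ℕ → Bool), IsProbabilityMeasure μ ∧ Measure.map T μ = μ ∧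
          measSupport μ = A ∧ (∀ᵐ x ∂lam, WeakTendsto (empMeasure T x) μ) ∧
          ¬ ComputableCantorMeasure μ) := by
  refine ⟨haltMap, haltShift, cantorComputable_haltMap, isClosed_haltShift,
    mapsTo_haltMap_haltShift, piOne_haltShift, manyOneReducible_haltShift,
    mapsTo_shiftMap_haltShift, fun x hx => haltMap_eq_shiftMap hx,
    fun U V _ hV hUA hVA => mixing_haltShift U V hV hUA hVA, coverEntropy_haltShift_pos,
    haltShift_eq_iInter, stronglyAttracting_haltShift, omegaSet_haltMap_subset,
    isTopAttractor_haltShift, fun lam _ hlam hsupp => ⟨isMetricAttractor_haltShift hlam hsupp,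
      lam.map fullErase, ?_⟩⟩
  have hprob : IsProbabilityMeasure (lam.map fullErase) :=
    Measure.isProbabilityMeasure_map measurable_fullErase.aemeasurable
  have hμ := measSupport_map_fullErase hsupp
  exact ⟨hprob, map_haltMap_map_fullErase hlam.toMeasurePreserving, hμ,
    ae_weakTendsto_empMeasure hlam, not_computableCantorMeasure hμ⟩
end
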